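/- For each fixed M ≥ 1, the speed p̄ ↦ v(M,p̄) is a continuous function of p̄ on the set Ω^u_M = {p̄ = (p_1,…,p_M) : 1/2 ≤ p_i < 1 for all i}. -/

import Mathlib

open MeasureTheory ProbabilityTheory Filter Finset Topology Asymptotics
open scoped ENNReal NNReal

noncomputable section

/-- Strength of the `i`-th cookie (1-indexed): `p i` for `1 ≤ i ≤ M`, `1/2` otherwise. -/
def strength (M : ℕ) (p : Fin M → ℝ) (i : ℕ) : ℝ :=
  if h : 1 ≤ i ∧ i ≤ M then p ⟨i - 1, by omega⟩ else 1 / 2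

/-- `α(M,p̄) = Σ_{i=1}^M (2 p_i − 1) − 1`. -/
def cookieAlpha (M : ℕ) (p : Fin M → ℝ) : ℝ := (∑ i, (2 * p i - 1)) - 1

/-- The set `Ω^u_M` of uniform cookie environments: `1/2 ≤ p_i < 1` for all `i`. -/
def OmegaU (M : ℕ) : Set (Fin M → ℝ) := {p | ∀ i, 1 / 2 ≤ p i ∧ p i < 1}

/-- `X` is an `(M,p̄)`-cookie random walk under the probability measure `P`: it starts at `0`,
is a nearest-neighbour path, and conditionally on the past it jumps to the right with
probability given by the strength of the cookie corresponding to the number of previous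
visits to the current site. -/
structure IsCookieRW {Ω : Type*} [MeasurableSpace Ω] (M : ℕ) (p : Fin M → ℝ)
    (P : Measure Ω) (X : ℕ → Ω → ℤ) : Prop where
  isProb : IsProbabilityMeasure P
  meas : ∀ n, Measurable (X n)
  init : P {ω | X 0 ω = 0} = 1
  nearest : P {ω | ∀ n, |X (n + 1) ω - X n ω| = 1} = 1
  step : ∀ (n : ℕ) (x : ℕ → ℤ),
    P {ω | (∀ k ≤ n, X k ω = x k) ∧ X (n + 1) ω = x n + 1}
      = ENNReal.ofReal
          (strength M p (((Finset.range (n + 1)).filter fun i => x i = x n).card))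
        * P {ω | ∀ k ≤ n, X k ω = x k}

/-- An environment of at most `M` cookies, indexed from `0`. -/
structure IsEnv (M : ℕ) (s : ℕ → ℝ) : Prop where
  half_le : ∀ i, 1 / 2 ≤ s i
  lt_one : ∀ i, s i < 1
  eq_half : ∀ i, M ≤ i → s i = 1 / 2

/-- The probability that, in independent trials `i, i + 1, …` of which the trial `l` succeeds with
probability `s l`, exactly `j` failures precede the `k`-th success. -/
def failPMF (s : ℕ → ℝ) : ℕ → ℕ → ℕ → ℝ
  | _, 0, 0 => 1
  | _, 0, _ + 1 => 0
  | i, k + 1, 0 => s i * failPMF s (i + 1) k 0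
  | i, k + 1, j + 1 =>
      s i * failPMF s (i + 1) k (j + 1) + (1 - s i) * failPMF s (i + 1) (k + 1) j
termination_by _ k j => k + j

/-- The expectation of `φ` at the number of failures before the `k`-th success. -/
def failExp (s : ℕ → ℝ) (i k : ℕ) (φ : ℕ → ℝ) : ℝ := ∑' j, failPMF s i k j * φ j

/-- Functions of at most quadratic growth, with constant `C`. -/
def QuadBound (C : ℝ) (φ : ℕ → ℝ) : Prop := ∀ j, |φ j| ≤ C * ((j : ℝ) + 1) ^ 2

/-- A summable majorant for `failPMF` against functions of quadratic growth. -/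
def failMajorant (k j : ℕ) : ℝ := ((j + k).choose k : ℝ) * (1 / 2) ^ j * ((j : ℝ) + 1) ^ 2

lemma failPMF_zero_left (s : ℕ → ℝ) (i j : ℕ) : failPMF s i 0 j = if j = 0 then 1 else 0 := by
  cases j <;> simp [failPMF]

lemma failPMF_nonneg {s : ℕ → ℝ} (h0 : ∀ i, 0 ≤ s i) (h1 : ∀ i, s i ≤ 1) (i k j : ℕ) :
    0 ≤ failPMF s i k j := by
  fun_induction failPMF s i k j with
  | case1 => norm_num
  | case2 => norm_num
  | case3 i k ih => exact mul_nonneg (h0 i) ih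
  | case4 i k j ih1 ih2 =>
    exact add_nonneg (mul_nonneg (h0 i) ih1) (mul_nonneg (sub_nonneg.2 (h1 i)) ih2)

lemma failPMF_le {s : ℕ → ℝ} (h0 : ∀ i, 1 / 2 ≤ s i) (h1 : ∀ i, s i ≤ 1) (i k j : ℕ) :
    failPMF s i k j ≤ ((j + k).choose k : ℝ) * (1 / 2) ^ j := by
  have hn := failPMF_nonneg (fun i => le_trans (by norm_num) (h0 i)) h1
  fun_induction failPMF s i k j with
  | case1 => norm_num
  | case2 => positivity
  | case3 i k ih =>
    have := hn (i + 1) k 0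
    simp at ih ⊢
    nlinarith [h1 i]
  | case4 i k j ih1 ih2 =>
    have a1 := hn (i + 1) k (j + 1)
    have a2 := hn (i + 1) (k + 1) j
    have e : ((j + 1 + (k + 1)).choose (k + 1) : ℝ)
        = (j + 1 + k).choose k + (j + (k + 1)).choose (k + 1) := by
      have := Nat.choose_succ_succ (j + 1 + k) k
      rw [show j + 1 + (k + 1) = (j + 1 + k).succ by omega, this]
      push_cast
      rw [show j + 1 + k = j + (k + 1) by omega]
    rw [e, add_mul]
    apply add_le_add
    · exact (mul_le_of_le_one_left a1 (h1 i)).trans ih1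
    · rw [pow_succ]
      nlinarith [h0 i]

lemma summable_failMajorant (k : ℕ) : Summable (failMajorant k) := by
  have h := summable_choose_mul_geometric_of_norm_lt_one (R := ℝ) (k + 2) (r := 1 / 2)
    (by norm_num)
  refine Summable.of_nonneg_of_le (fun j => by unfold failMajorant; positivity) (fun j => ?_)
    (h.mul_left (((k : ℝ) + 1) * (k + 2)))
  have e1 := Nat.add_one_mul_choose_eq (j + k) k
  have e2 := Nat.add_one_mul_choose_eq (j + k + 1) (k + 1)
  have e1' : ((j : ℝ) + k + 1) * ((j + k).choose k : ℝ)
      = ((j + k + 1).choose (k + 1) : ℝ) * (k + 1) := by exact_mod_cast e1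
  have e2' : ((j : ℝ) + k + 2) * ((j + k + 1).choose (k + 1) : ℝ)
      = ((j + (k + 2)).choose (k + 2) : ℝ) * (k + 2) := by
    have : (((j + k + 1 + 1 : ℕ) : ℝ)) * ((j + k + 1).choose (k + 1) : ℝ)
      = ((j + k + 1 + 1).choose (k + 1 + 1) : ℝ) * ((k + 1 + 1 : ℕ) : ℝ) := by exact_mod_cast e2
    push_cast at this
    rw [show j + (k + 2) = j + k + 1 + 1 by omega, show k + 2 = k + 1 + 1 by omega]
    linarith
  have key : ((j + k).choose k : ℝ) * ((j : ℝ) + 1) ^ 2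
      ≤ (((k : ℝ) + 1) * (k + 2)) * ((j + (k + 2)).choose (k + 2) : ℝ) := by
    have : (((k : ℝ) + 1) * (k + 2)) * ((j + (k + 2)).choose (k + 2) : ℝ)
        = ((j + k).choose k : ℝ) * ((j + k + 1) * (j + k + 2)) := by
      linear_combination (-(k : ℝ) - 1) * e2' - ((j : ℝ) + k + 2) * e1'
    rw [this]
    have hj : (0 : ℝ) ≤ j := by positivity
    have hk : (0 : ℝ) ≤ k := by positivity
    gcongr
    nlinarith
  calc failMajorant k j = (((j + k).choose k : ℝ) * ((j : ℝ) + 1) ^ 2) * (1 / 2) ^ j := by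
        unfold failMajorant; ring
    _ ≤ _ := by rw [← mul_assoc]; gcongr

lemma abs_failPMF_mul_le {s : ℕ → ℝ} (h0 : ∀ i, 1 / 2 ≤ s i) (h1 : ∀ i, s i ≤ 1) {C : ℝ}
    {φ : ℕ → ℝ} (hφ : QuadBound C φ) (i k j : ℕ) :
    |failPMF s i k j * φ j| ≤ C * failMajorant k j := by
  have hn := failPMF_nonneg (fun i => le_trans (by norm_num) (h0 i)) h1 i k j
  rw [abs_mul, abs_of_nonneg hn]
  calc failPMF s i k j * |φ j|
      ≤ (((j + k).choose k : ℝ) * (1 / 2) ^ j) * (C * ((j : ℝ) + 1) ^ 2) :=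
        mul_le_mul (failPMF_le h0 h1 i k j) (hφ j) (abs_nonneg _) (by positivity)
    _ = _ := by unfold failMajorant; ring

namespace IsEnv

variable {M : ℕ} {s : ℕ → ℝ}

lemma le_one (h : IsEnv M s) (i : ℕ) : s i ≤ 1 := (h.lt_one i).le

lemma nonneg (h : IsEnv M s) (i : ℕ) : 0 ≤ s i := le_trans (by norm_num) (h.half_le i)

lemma failPMF_nonneg (h : IsEnv M s) (i k j : ℕ) : 0 ≤ failPMF s i k j :=
  _root_.failPMF_nonneg h.nonneg h.le_one i k j

lemma summable (h : IsEnv M s) {C : ℝ} {φ : ℕ → ℝ} (hφ : QuadBound C φ) (i k : ℕ) :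
    Summable fun j => failPMF s i k j * φ j :=
  Summable.of_norm_bounded ((summable_failMajorant k).mul_left C)
    (abs_failPMF_mul_le h.half_le h.le_one hφ i k)

end IsEnv

/-- Continuity of `failExp` jointly in the environment and the test function. -/
lemma tendsto_failExp {ι : Type*} {l : Filter ι} {M : ℕ} {s : ι → ℕ → ℝ} {t : ℕ → ℝ}
    (hs : ∀ᶠ x in l, IsEnv M (s x)) (hst : ∀ i, Tendsto (fun x => s x i) l (𝓝 (t i)))
    {C : ℝ} {φ : ι → ℕ → ℝ} {ψ : ℕ → ℝ} (hφ : ∀ᶠ x in l, QuadBound C (φ x))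
    (hφψ : ∀ j, Tendsto (fun x => φ x j) l (𝓝 (ψ j))) (i k : ℕ) :
    Tendsto (fun x => failExp (s x) i k (φ x)) l (𝓝 (failExp t i k ψ)) := by
  have hp : ∀ i k j, Tendsto (fun x => failPMF (s x) i k j) l (𝓝 (failPMF t i k j)) := by
    intro i k j
    fun_induction failPMF t i k j with
    | case1 => simpa [failPMF] using tendsto_const_nhds
    | case2 => simpa [failPMF] using tendsto_const_nhds
    | case3 i k ih => simpa only [failPMF] using (hst i).mul ih
    | case4 i k j ih1 ih2 =>
      simpa only [failPMF] using ((hst i).mul ih1).add ((tendsto_const_nhds.sub (hst i)).mul ih2)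
  refine tendsto_tsum_of_dominated_convergence ((summable_failMajorant k).mul_left C)
    (fun j => (hp i k j).mul (hφψ j)) ?_
  filter_upwards [hs, hφ] with x hx hφx j
  exact abs_failPMF_mul_le hx.half_le hx.le_one hφx i k j

/-- Functions of at most quadratic growth. -/
def QuadBdd (φ : ℕ → ℝ) : Prop := ∃ C, QuadBound C φ

namespace QuadBdd

variable {φ ψ : ℕ → ℝ}

lemma add (h : QuadBdd φ) (h' : QuadBdd ψ) : QuadBdd fun j => φ j + ψ j := by
  obtain ⟨C, hC⟩ := h
  obtain ⟨D, hD⟩ := h'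
  exact ⟨C + D, fun j => by
    have := abs_add_le (φ j) (ψ j)
    linarith [hC j, hD j, add_mul C D (((j : ℝ) + 1) ^ 2)]⟩

lemma const_mul (h : QuadBdd φ) (a : ℝ) : QuadBdd fun j => a * φ j := by
  obtain ⟨C, hC⟩ := h
  exact ⟨|a| * C, fun j => by
    rw [abs_mul, mul_assoc]; exact mul_le_mul_of_nonneg_left (hC j) (abs_nonneg a)⟩

lemma sub (h : QuadBdd φ) (h' : QuadBdd ψ) : QuadBdd fun j => φ j - ψ j := by
  have := h.add (h'.const_mul (-1))
  simpa [sub_eq_add_neg] using this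

lemma const (a : ℝ) : QuadBdd fun _ => a :=
  ⟨|a|, fun j => by
    have : (1 : ℝ) ≤ ((j : ℝ) + 1) ^ 2 := by
      have : (0 : ℝ) ≤ j := by positivity
      nlinarith
    nlinarith [abs_nonneg a]⟩

lemma sq : QuadBdd fun j => (j : ℝ) ^ 2 :=
  ⟨1, fun j => by
    have : (0 : ℝ) ≤ j := by positivity
    rw [abs_of_nonneg (by positivity)]; nlinarith⟩

lemma mono (h : QuadBdd ψ) (hle : ∀ j, |φ j| ≤ |ψ j|) : QuadBdd φ := by
  obtain ⟨C, hC⟩ := h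
  exact ⟨C, fun j => (hle j).trans (hC j)⟩

lemma natCast : QuadBdd fun j => (j : ℝ) :=
  sq.mono fun j => by
    rw [abs_of_nonneg (by positivity), abs_of_nonneg (by positivity)]
    exact_mod_cast Nat.le_self_pow two_ne_zero j

lemma of_bounded {a : ℝ} (h : ∀ j, |φ j| ≤ a) : QuadBdd φ :=
  (const a).mono fun j => (h j).trans (le_abs_self a)

end QuadBdd

lemma QuadBound.succ {C : ℝ} {φ : ℕ → ℝ} (h : QuadBound C φ) :
    QuadBound (4 * C) fun j => φ (j + 1) := fun j => by
  have h0 := h 0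
  have hC : 0 ≤ C := by simpa using (abs_nonneg _).trans h0
  refine (h (j + 1)).trans ?_
  have : (0 : ℝ) ≤ j := by positivity
  push_cast
  have : ((j : ℝ) + 1 + 1) ^ 2 ≤ 4 * ((j : ℝ) + 1) ^ 2 := by nlinarith
  nlinarith

lemma QuadBdd.succ {φ : ℕ → ℝ} (h : QuadBdd φ) : QuadBdd fun j => φ (j + 1) := by
  obtain ⟨C, hC⟩ := h
  exact ⟨_, hC.succ⟩

@[elab_as_elim]
lemma nat_backward_induction {p : ℕ → Prop} (M : ℕ) (base : ∀ i, M ≤ i → p i)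
    (step : ∀ i, i < M → p (i + 1) → p i) (i : ℕ) : p i := by
  have : ∀ d i, M ≤ i + d → p i := by
    intro d
    induction d with
    | zero => exact fun i hi => base i hi
    | succ d ih =>
      intro i hi
      rcases le_or_gt M i with h | h
      · exact base i h
      · exact step i h (ih (i + 1) (by omega))
  exact this M i (by omega)

namespace IsEnv

variable {M : ℕ} {s : ℕ → ℝ}

lemma summable' (h : IsEnv M s) {φ : ℕ → ℝ} (hφ : QuadBdd φ) (i k : ℕ) :
    Summable fun j => failPMF s i k j * φ j := by
  obtain ⟨C, hC⟩ := hφ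
  exact h.summable hC i k

lemma failExp_zero (φ : ℕ → ℝ) (i : ℕ) : failExp s i 0 φ = φ 0 := by
  unfold failExp
  rw [tsum_eq_single 0]
  · simp [failPMF]
  · intro j hj
    simp [failPMF_zero_left, hj]

lemma failExp_succ (h : IsEnv M s) {φ : ℕ → ℝ} (hφ : QuadBdd φ) (i k : ℕ) :
    failExp s i (k + 1) φ
      = s i * failExp s (i + 1) k φ + (1 - s i) * failExp s (i + 1) (k + 1) fun j => φ (j + 1) := by
  have S0 := h.summable' hφ i (k + 1)
  have S1 := h.summable' hφ (i + 1) k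
  have S2 := h.summable' hφ.succ (i + 1) (k + 1)
  have S1' := (summable_nat_add_iff 1).2 S1
  unfold failExp
  rw [S0.tsum_eq_zero_add, S1.tsum_eq_zero_add]
  have : (fun j => failPMF s i (k + 1) (j + 1) * φ (j + 1)) = fun j =>
      s i * (failPMF s (i + 1) k (j + 1) * φ (j + 1))
        + (1 - s i) * (failPMF s (i + 1) (k + 1) j * φ (j + 1)) := by
    funext j; simp only [failPMF]; ring
  rw [this, (S1'.mul_left _).tsum_add (S2.mul_left _), tsum_mul_left, tsum_mul_left]
  simp only [failPMF]
  ring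

lemma failExp_add (h : IsEnv M s) {φ ψ : ℕ → ℝ} (hφ : QuadBdd φ) (hψ : QuadBdd ψ) (i k : ℕ) :
    failExp s i k (fun j => φ j + ψ j) = failExp s i k φ + failExp s i k ψ := by
  unfold failExp
  simp only [mul_add]
  exact (h.summable' hφ i k).tsum_add (h.summable' hψ i k)

lemma failExp_const_mul (φ : ℕ → ℝ) (a : ℝ) (i k : ℕ) :
    failExp s i k (fun j => a * φ j) = a * failExp s i k φ := by
  unfold failExp
  rw [← tsum_mul_left]
  congr 1; funext j; ring

lemma failExp_sub (h : IsEnv M s) {φ ψ : ℕ → ℝ} (hφ : QuadBdd φ) (hψ : QuadBdd ψ) (i k : ℕ) :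
    failExp s i k (fun j => φ j - ψ j) = failExp s i k φ - failExp s i k ψ := by
  unfold failExp
  simp only [mul_sub]
  exact (h.summable' hφ i k).tsum_sub (h.summable' hψ i k)

lemma failExp_mono (h : IsEnv M s) {φ ψ : ℕ → ℝ} (hφ : QuadBdd φ) (hψ : QuadBdd ψ)
    (hle : ∀ j, φ j ≤ ψ j) (i k : ℕ) : failExp s i k φ ≤ failExp s i k ψ :=
  (h.summable' hφ i k).tsum_le_tsum
    (fun j => mul_le_mul_of_nonneg_left (hle j) (h.failPMF_nonneg i k j)) (h.summable' hψ i k)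

lemma failPMF_succ_of_le (h : IsEnv M s) {i : ℕ} (hi : M ≤ i) (k j : ℕ) :
    failPMF s (i + 1) k j = failPMF s i k j := by
  fun_induction failPMF s i k j with
  | case1 => simp [failPMF]
  | case2 => simp [failPMF]
  | case3 i k ih =>
    rw [failPMF, ih (by omega), h.eq_half i hi, h.eq_half (i + 1) (by omega)]
  | case4 i k j ih1 ih2 =>
    rw [failPMF, ih1 (by omega), ih2 (by omega), h.eq_half i hi, h.eq_half (i + 1) (by omega)]

lemma failExp_succ_of_le (h : IsEnv M s) {i : ℕ} (hi : M ≤ i) {φ : ℕ → ℝ} (hφ : QuadBdd φ)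
    (k : ℕ) : failExp s i (k + 1) φ
      = (1 / 2) * failExp s i k φ + (1 / 2) * failExp s i (k + 1) fun j => φ (j + 1) := by
  rw [h.failExp_succ hφ, h.eq_half i hi]
  simp only [failExp, h.failPMF_succ_of_le hi]
  norm_num

lemma failExp_one (h : IsEnv M s) (i k : ℕ) : failExp s i k (fun _ => 1) = 1 := by
  revert k
  refine nat_backward_induction M (fun i hi k => ?_) (fun i hi ih k => ?_) i
  · induction k with
    | zero => simp [failExp_zero]
    | succ k ih =>
      have := h.failExp_succ_of_le hi (QuadBdd.const 1) k
      linarith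
  · cases k with
    | zero => simp [failExp_zero]
    | succ k => rw [h.failExp_succ (QuadBdd.const 1), ih, ih]; ring

lemma failExp_const (h : IsEnv M s) (a : ℝ) (i k : ℕ) : failExp s i k (fun _ => a) = a := by
  have := failExp_const_mul (s := s) (fun _ => 1) a i k
  simpa [h.failExp_one] using this

lemma failExp_succ_natCast (h : IsEnv M s) (i k : ℕ) :
    failExp s i k (fun j => ((j + 1 : ℕ) : ℝ)) = failExp s i k (fun j => (j : ℝ)) + 1 := by
  push_cast
  rw [h.failExp_add QuadBdd.natCast (QuadBdd.const 1), h.failExp_one]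

lemma failExp_succ_sq (h : IsEnv M s) (i k : ℕ) :
    failExp s i k (fun j => ((j + 1 : ℕ) : ℝ) ^ 2)
      = failExp s i k (fun j => (j : ℝ) ^ 2) + 2 * failExp s i k (fun j => (j : ℝ)) + 1 := by
  have : (fun j : ℕ => ((j + 1 : ℕ) : ℝ) ^ 2) = fun j : ℕ => ((j : ℝ) ^ 2 + 2 * (j : ℝ)) + 1 := by
    funext j; push_cast; ring
  rw [this, h.failExp_add (QuadBdd.sq.add (QuadBdd.natCast.const_mul 2)) (QuadBdd.const 1),
    h.failExp_add QuadBdd.sq (QuadBdd.natCast.const_mul 2), failExp_const_mul, h.failExp_one]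

/-- The total drift stored in the cookies from the `i`-th on. -/
def drift (M : ℕ) (s : ℕ → ℝ) (i : ℕ) : ℝ := ∑ l ∈ Finset.Ico i M, (2 * s l - 1)

lemma drift_of_le {i : ℕ} (hi : M ≤ i) : drift M s i = 0 := by
  simp [drift, Finset.Ico_eq_empty_of_le hi]

lemma drift_of_lt {i : ℕ} (hi : i < M) : drift M s i = (2 * s i - 1) + drift M s (i + 1) := by
  rw [drift, drift, Finset.sum_eq_sum_Ico_succ_bot hi]

lemma failExp_natCast_of_le (h : IsEnv M s) {i : ℕ} (hi : M ≤ i) (k : ℕ) :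
    failExp s i k (fun j => (j : ℝ)) = k := by
  induction k with
  | zero => simp [failExp_zero]
  | succ k ih =>
    have := h.failExp_succ_of_le hi QuadBdd.natCast k
    rw [h.failExp_succ_natCast] at this
    push_cast
    linarith

lemma failExp_sq_of_le (h : IsEnv M s) {i : ℕ} (hi : M ≤ i) (k : ℕ) :
    failExp s i k (fun j => (j : ℝ) ^ 2) = (k : ℝ) ^ 2 + 2 * k := by
  induction k with
  | zero => simp [failExp_zero]
  | succ k ih =>
    have := h.failExp_succ_of_le hi QuadBdd.sq k
    rw [h.failExp_succ_sq, h.failExp_natCast_of_le hi] at this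
    push_cast at this ⊢
    linarith

lemma failExp_natCast_eq (h : IsEnv M s) (i k : ℕ) (hik : M ≤ i + k) :
    failExp s i k (fun j => (j : ℝ)) = k - drift M s i := by
  revert k
  refine nat_backward_induction M (fun i hi k _ => ?_) (fun i hi ih k hk => ?_) i
  · rw [h.failExp_natCast_of_le hi, drift_of_le hi, sub_zero]
  · obtain ⟨k, rfl⟩ : ∃ k', k = k' + 1 := ⟨k - 1, by omega⟩
    rw [h.failExp_succ QuadBdd.natCast, h.failExp_succ_natCast, ih k (by omega),
      ih (k + 1) (by omega), drift_of_lt hi]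
    push_cast
    ring

lemma exists_failExp_sq_eq (h : IsEnv M s) (i : ℕ) : ∃ C : ℝ, ∀ k, M ≤ i + k →
    failExp s i k (fun j => (j : ℝ) ^ 2) = (k : ℝ) ^ 2 + (2 - 2 * drift M s i) * k + C := by
  refine nat_backward_induction M (fun i hi => ⟨0, fun k _ => ?_⟩) (fun i hi => ?_) i
  · rw [h.failExp_sq_of_le hi, drift_of_le hi]; ring
  · rintro ⟨C, hC⟩
    refine ⟨C + (2 * s i - 1) * (2 * drift M s (i + 1) - 1), fun k hk => ?_⟩
    obtain ⟨k, rfl⟩ : ∃ k', k = k' + 1 := ⟨k - 1, by omega⟩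
    rw [h.failExp_succ QuadBdd.sq, h.failExp_succ_sq, hC k (by omega), hC (k + 1) (by omega),
      h.failExp_natCast_eq (i + 1) (k + 1) (by omega), drift_of_lt hi]
    push_cast
    ring

lemma failExp_natCast_le (h : IsEnv M s) (i k : ℕ) : failExp s i k (fun j => (j : ℝ)) ≤ k := by
  revert k
  refine nat_backward_induction M (fun i hi k => ?_) (fun i hi ih k => ?_) i
  · rw [h.failExp_natCast_of_le hi]
  · cases k with
    | zero => simp [failExp_zero]
    | succ k =>
      rw [h.failExp_succ QuadBdd.natCast, h.failExp_succ_natCast]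
      have h1 := mul_le_mul_of_nonneg_left (ih k) (h.nonneg i)
      have h2 := mul_le_mul_of_nonneg_left (ih (k + 1)) (sub_nonneg.2 (h.le_one i))
      have := h.half_le i
      push_cast at h2 ⊢
      linarith

lemma failExp_sq_le (h : IsEnv M s) (i k : ℕ) :
    failExp s i k (fun j => (j : ℝ) ^ 2) ≤ (k : ℝ) ^ 2 + 2 * k := by
  revert k
  refine nat_backward_induction M (fun i hi k => ?_) (fun i hi ih k => ?_) i
  · rw [h.failExp_sq_of_le hi]
  · cases k with
    | zero => simp [failExp_zero]
    | succ k =>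
      rw [h.failExp_succ QuadBdd.sq, h.failExp_succ_sq]
      have h1 := mul_le_mul_of_nonneg_left (ih k) (h.nonneg i)
      have h2 := mul_le_mul_of_nonneg_left (ih (k + 1)) (sub_nonneg.2 (h.le_one i))
      have h3 := mul_le_mul_of_nonneg_left (h.failExp_natCast_le (i + 1) (k + 1))
        (sub_nonneg.2 (h.le_one i))
      have h4 := h.half_le i
      have h5 : (0 : ℝ) ≤ k := by positivity
      have h6 : 0 ≤ (2 * s i - 1) * (2 * k + 3) :=
        mul_nonneg (by linarith) (by linarith)
      push_cast at h2 h3 ⊢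
      nlinarith

/-- The expected number of failures between consecutive successes is at most `1`, with equality
only if all the cookies that may be used are trivial. -/
lemma failExp_natCast_succ_le (h : IsEnv M s) (i k : ℕ) :
    failExp s i (k + 1) (fun j => (j : ℝ)) ≤ failExp s i k (fun j => (j : ℝ)) + 1 ∧
      (failExp s i (k + 1) (fun j => (j : ℝ)) = failExp s i k (fun j => (j : ℝ)) + 1 →
        ∀ l, i + k ≤ l → s l = 1 / 2) := by
  revert k
  refine nat_backward_induction M (fun i hi k => ?_) (fun i hi ih k => ?_) i
  · rw [h.failExp_natCast_of_le hi, h.failExp_natCast_of_le hi]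
    exact ⟨by push_cast; rfl, fun _ l hl => h.eq_half l (by omega)⟩
  · have h1 := h.half_le i
    have h2 := h.lt_one i
    cases k with
    | zero =>
      rw [h.failExp_succ QuadBdd.natCast, h.failExp_succ_natCast]
      obtain ⟨a, b⟩ := ih 0
      simp only [failExp_zero, Nat.cast_zero, zero_add] at a b ⊢
      have h3 := mul_le_mul_of_nonneg_left a (sub_nonneg.2 h2.le)
      refine ⟨by linarith, fun he l hl => ?_⟩
      have hs : s i = 1 / 2 := by linarith
      rcases Nat.eq_or_lt_of_le hl with hl | hl
      · rwa [← hl]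
      · refine b ?_ l (by omega)
        rw [hs] at he
        linarith
    | succ k =>
      obtain ⟨a, b⟩ := ih k
      have a' := (ih (k + 1)).1
      rw [h.failExp_succ QuadBdd.natCast i (k + 1), h.failExp_succ_natCast,
        h.failExp_succ QuadBdd.natCast i k, h.failExp_succ_natCast]
      have h3 := mul_le_mul_of_nonneg_left a (h.nonneg i)
      have h4 := mul_le_mul_of_nonneg_left a' (sub_nonneg.2 h2.le)
      refine ⟨by linarith, fun he l hl => ?_⟩
      refine b (le_antisymm a ?_) l (by omega)
      by_contra! hlt
      have h5 := mul_lt_mul_of_pos_left hlt (lt_of_lt_of_le (by norm_num) h1)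
      linarith

end IsEnv

/-- The Markov operator of the branching process with migration attached to the environment `s`:
from `k`, the process jumps to the number of failures before the `(k + 1)`-th success. -/
def stepOp (s : ℕ → ℝ) (φ : ℕ → ℝ) (k : ℕ) : ℝ := failExp s 0 (k + 1) φ

/-- The expectation of `φ` at time `n` for the branching process started at `0`. -/
def chain (s : ℕ → ℝ) (n : ℕ) (φ : ℕ → ℝ) : ℝ := (stepOp s)^[n] φ 0

lemma chain_zero (s : ℕ → ℝ) (φ : ℕ → ℝ) : chain s 0 φ = φ 0 := rfl

lemma chain_succ (s : ℕ → ℝ) (n : ℕ) (φ : ℕ → ℝ) : chain s (n + 1) φ = chain s n (stepOp s φ) := rfl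

/-- The indicator function of `{0, …, k}`. -/
def indLE (k j : ℕ) : ℝ := if j ≤ k then 1 else 0

lemma quadBdd_indLE (k : ℕ) : QuadBdd (indLE k) :=
  QuadBdd.of_bounded (a := 1) fun j => by unfold indLE; split_ifs <;> simp

namespace IsEnv

variable {M : ℕ} {s : ℕ → ℝ}

lemma sum_failPMF_le_one (h : IsEnv M s) (i k m : ℕ) :
    ∑ j ∈ Finset.range m, failPMF s i k j ≤ 1 := by
  have hs : Summable fun j => failPMF s i k j := by
    simpa using h.summable' (QuadBdd.const 1) i k
  have h1 : ∑' j, failPMF s i k j = 1 := by simpa [failExp] using h.failExp_one i k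
  rw [← h1]
  exact hs.sum_le_tsum _ fun j _ => h.failPMF_nonneg i k j

lemma sum_failPMF_succ (i k m : ℕ) :
    ∑ j ∈ Finset.range (m + 1), failPMF s i (k + 1) j
      = s i * ∑ j ∈ Finset.range (m + 1), failPMF s (i + 1) k j
        + (1 - s i) * ∑ j ∈ Finset.range m, failPMF s (i + 1) (k + 1) j := by
  rw [Finset.sum_range_succ', Finset.sum_range_succ' (fun j => failPMF s (i + 1) k j)]
  simp only [failPMF, Finset.sum_add_distrib, ← Finset.mul_sum]
  ring

lemma sum_failPMF_anti (h : IsEnv M s) (i k m : ℕ) :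
    ∑ j ∈ Finset.range m, failPMF s i (k + 1) j ≤ ∑ j ∈ Finset.range m, failPMF s i k j := by
  induction m generalizing i k with
  | zero => simp
  | succ m ihm =>
    induction k generalizing i with
    | zero =>
      refine (h.sum_failPMF_le_one i 1 (m + 1)).trans (le_of_eq ?_)
      simp [failPMF_zero_left]
    | succ k ihk =>
      rw [sum_failPMF_succ i (k+1) m, sum_failPMF_succ i k m]
      exact add_le_add (mul_le_mul_of_nonneg_left (ihk _) (h.nonneg i))
        (mul_le_mul_of_nonneg_left (ihm _ _) (sub_nonneg.2 (h.le_one i)))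

lemma failExp_le_succ_of_nonneg (h : IsEnv M s) {φ : ℕ → ℝ} (hφ : QuadBdd φ) (hm : Monotone φ)
    (h0 : ∀ j, 0 ≤ φ j) (i k : ℕ) : failExp s i k φ ≤ failExp s i (k + 1) φ := by
  have S := h.summable' hφ i (k + 1)
  have S1 : Summable fun j => failPMF s i (k + 1) j := by
    simpa using h.summable' (QuadBdd.const 1) i (k + 1)
  have T1 : ∑' j, failPMF s i (k + 1) j = 1 := by simpa [failExp] using h.failExp_one i (k + 1)
  refine Real.tsum_le_of_sum_range_le
    (fun j => mul_nonneg (h.failPMF_nonneg i k j) (h0 j)) fun J => ?_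
  have abel : ∀ J, ∑ j ∈ Finset.range J, failPMF s i k j * φ j
      - ∑ j ∈ Finset.range J, failPMF s i (k + 1) j * φ j
      ≤ (∑ j ∈ Finset.range J, failPMF s i k j
        - ∑ j ∈ Finset.range J, failPMF s i (k + 1) j) * φ J := by
    intro J
    induction J with
    | zero => simp
    | succ J ih =>
      have a := sub_nonneg.2 (h.sum_failPMF_anti i k (J + 1))
      have b := mul_le_mul_of_nonneg_left (hm (Nat.le_succ J)) a
      refine le_trans ?_ b
      simp only [Finset.sum_range_succ]
      linarith
  have tail : (1 - ∑ j ∈ Finset.range J, failPMF s i (k + 1) j) * φ J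
      ≤ failExp s i (k + 1) φ - ∑ j ∈ Finset.range J, failPMF s i (k + 1) j * φ j := by
    have e1 := S1.sum_add_tsum_nat_add J
    have e2 := S.sum_add_tsum_nat_add J
    rw [T1] at e1
    rw [← e1, failExp, ← e2, add_sub_cancel_left, add_sub_cancel_left, ← tsum_mul_right]
    refine Summable.tsum_le_tsum (fun j => ?_) (((summable_nat_add_iff J).2 S1).mul_right _)
      ((summable_nat_add_iff J).2 S)
    exact mul_le_mul_of_nonneg_left (hm (by omega)) (h.failPMF_nonneg _ _ _)
  have := mul_le_mul_of_nonneg_right (h.sum_failPMF_le_one i k J) (h0 J)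
  have := abel J
  linarith

lemma failExp_le_succ (h : IsEnv M s) {φ : ℕ → ℝ} (hφ : QuadBdd φ) (hm : Monotone φ) (i k : ℕ) :
    failExp s i k φ ≤ failExp s i (k + 1) φ := by
  have := h.failExp_le_succ_of_nonneg (hφ.sub (QuadBdd.const (φ 0)))
    (fun a b hab => sub_le_sub_right (hm hab) _) (fun j => sub_nonneg.2 (hm (Nat.zero_le j))) i k
  rw [h.failExp_sub hφ (QuadBdd.const _), h.failExp_sub hφ (QuadBdd.const _), h.failExp_const,
    h.failExp_const] at this
  linarith

lemma quadBound_stepOp (h : IsEnv M s) {C : ℝ} {φ : ℕ → ℝ} (hφ : QuadBound C φ) :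
    QuadBound (9 * C) (stepOp s φ) := fun k => by
  have hC : 0 ≤ C := by simpa using (abs_nonneg _).trans (hφ 0)
  have e : (fun j : ℕ => C * ((j : ℝ) + 1) ^ 2)
      = fun j : ℕ => C * (((j : ℝ) ^ 2 + 2 * (j : ℝ)) + 1) := by funext j; ring
  have q1 := QuadBdd.sq.add (QuadBdd.natCast.const_mul 2)
  have q : QuadBdd fun j : ℕ => C * ((j : ℝ) + 1) ^ 2 := by
    rw [e]; exact (q1.add (QuadBdd.const 1)).const_mul C
  have key : failExp s 0 (k + 1) (fun j : ℕ => C * ((j : ℝ) + 1) ^ 2)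
      ≤ 9 * C * ((k : ℝ) + 1) ^ 2 := by
    rw [e, failExp_const_mul, h.failExp_add q1 (QuadBdd.const 1),
      h.failExp_add QuadBdd.sq (QuadBdd.natCast.const_mul 2), failExp_const_mul, h.failExp_one]
    have a := h.failExp_sq_le 0 (k + 1)
    have b := h.failExp_natCast_le 0 (k + 1)
    have hk : (0 : ℝ) ≤ k := by positivity
    push_cast at a b
    rw [mul_comm 9 C, mul_assoc]
    refine mul_le_mul_of_nonneg_left ?_ hC
    nlinarith
  have hQ : QuadBdd φ := ⟨C, hφ⟩
  refine abs_le.2 ⟨?_, ?_⟩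
  · have := h.failExp_mono (q.const_mul (-1)) hQ (fun j => by
      have := (abs_le.1 (hφ j)).1; linarith) 0 (k + 1)
    rw [failExp_const_mul] at this
    unfold stepOp
    linarith
  · have := h.failExp_mono hQ q (fun j => (abs_le.1 (hφ j)).2) 0 (k + 1)
    unfold stepOp
    linarith

lemma quadBdd_stepOp (h : IsEnv M s) {φ : ℕ → ℝ} (hφ : QuadBdd φ) : QuadBdd (stepOp s φ) := by
  obtain ⟨C, hC⟩ := hφ
  exact ⟨_, h.quadBound_stepOp hC⟩

lemma monotone_stepOp (h : IsEnv M s) {φ : ℕ → ℝ} (hφ : QuadBdd φ) (hm : Monotone φ) :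
    Monotone (stepOp s φ) :=
  monotone_nat_of_le_succ fun k => h.failExp_le_succ hφ hm 0 (k + 1)

lemma chain_add (h : IsEnv M s) {φ ψ : ℕ → ℝ} (hφ : QuadBdd φ) (hψ : QuadBdd ψ) (n : ℕ) :
    chain s n (fun j => φ j + ψ j) = chain s n φ + chain s n ψ := by
  induction n generalizing φ ψ with
  | zero => rfl
  | succ n ih =>
    simp only [chain_succ]
    rw [← ih (h.quadBdd_stepOp hφ) (h.quadBdd_stepOp hψ)]
    congr 1; funext k; exact h.failExp_add hφ hψ 0 (k + 1)

lemma chain_const_mul (φ : ℕ → ℝ) (a : ℝ) (n : ℕ) :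
    chain s n (fun j => a * φ j) = a * chain s n φ := by
  induction n generalizing φ with
  | zero => rfl
  | succ n ih =>
    simp only [chain_succ]
    rw [← ih]
    congr 1; funext k; exact failExp_const_mul φ a 0 (k + 1)

lemma chain_sub (h : IsEnv M s) {φ ψ : ℕ → ℝ} (hφ : QuadBdd φ) (hψ : QuadBdd ψ) (n : ℕ) :
    chain s n (fun j => φ j - ψ j) = chain s n φ - chain s n ψ := by
  have := h.chain_add hφ (hψ.const_mul (-1)) n
  rw [chain_const_mul] at this
  rw [sub_eq_add_neg, ← neg_one_mul, ← this]
  congr 1; funext j; ring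

lemma chain_const (h : IsEnv M s) (a : ℝ) (n : ℕ) : chain s n (fun _ => a) = a := by
  induction n with
  | zero => rfl
  | succ n ih =>
    rw [chain_succ]
    conv_rhs => rw [← ih]
    congr 1; funext k; exact h.failExp_const a 0 (k + 1)

lemma chain_mono (h : IsEnv M s) {φ ψ : ℕ → ℝ} (hφ : QuadBdd φ) (hψ : QuadBdd ψ)
    (hle : ∀ j, φ j ≤ ψ j) (n : ℕ) : chain s n φ ≤ chain s n ψ := by
  induction n generalizing φ ψ with
  | zero => exact hle 0
  | succ n ih =>
    exact ih (h.quadBdd_stepOp hφ) (h.quadBdd_stepOp hψ)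
      fun k => h.failExp_mono hφ hψ hle 0 (k + 1)

lemma chain_sum (h : IsEnv M s) {ι : Type*} (t : Finset ι) (c : ι → ℝ) (φ : ι → ℕ → ℝ)
    (hφ : ∀ i, QuadBdd (φ i)) (n : ℕ) :
    QuadBdd (fun j => ∑ i ∈ t, c i * φ i j) ∧
      chain s n (fun j => ∑ i ∈ t, c i * φ i j) = ∑ i ∈ t, c i * chain s n (φ i) := by
  classical
  induction t using Finset.induction_on with
  | empty => simpa using ⟨QuadBdd.const 0, h.chain_const 0 n⟩
  | insert a t ha ih =>
    simp only [Finset.sum_insert ha]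
    refine ⟨((hφ a).const_mul _).add ih.1, ?_⟩
    rw [h.chain_add ((hφ a).const_mul _) ih.1, chain_const_mul, ih.2]

lemma chain_le_succ (h : IsEnv M s) {φ : ℕ → ℝ} (hφ : QuadBdd φ) (hm : Monotone φ) (n : ℕ) :
    chain s n φ ≤ chain s (n + 1) φ := by
  induction n generalizing φ with
  | zero =>
    have := h.failExp_mono (QuadBdd.const (φ 0)) hφ (fun j => hm (Nat.zero_le j)) 0 (0 + 1)
    rwa [h.failExp_const] at this
  | succ n ih => exact ih (h.quadBdd_stepOp hφ) (h.monotone_stepOp hφ hm)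

lemma monotone_chain (h : IsEnv M s) {φ : ℕ → ℝ} (hφ : QuadBdd φ) (hm : Monotone φ) :
    Monotone fun n => chain s n φ :=
  monotone_nat_of_le_succ fun n => h.chain_le_succ hφ hm n

end IsEnv

/-- Continuity of `chain` jointly in the environment and the test function. -/
lemma tendsto_chain {ι : Type*} {l : Filter ι} {M : ℕ} {s : ι → ℕ → ℝ} {t : ℕ → ℝ}
    (hs : ∀ᶠ x in l, IsEnv M (s x)) (hst : ∀ i, Tendsto (fun x => s x i) l (𝓝 (t i)))
    {C : ℝ} {φ : ι → ℕ → ℝ} {ψ : ℕ → ℝ} (hφ : ∀ᶠ x in l, QuadBound C (φ x))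
    (hφψ : ∀ j, Tendsto (fun x => φ x j) l (𝓝 (ψ j))) (n : ℕ) :
    Tendsto (fun x => chain (s x) n (φ x)) l (𝓝 (chain t n ψ)) := by
  induction n generalizing C φ ψ with
  | zero => exact hφψ 0
  | succ n ih =>
    refine ih (C := 9 * C) ?_ fun k => tendsto_failExp hs hst hφ hφψ 0 (k + 1)
    filter_upwards [hs, hφ] with x hx hφx using hx.quadBound_stepOp hφx

lemma antitone_indLE (k : ℕ) : Antitone (indLE k) := fun a b hab => by
  unfold indLE
  split_ifs <;> first | omega | norm_num

/-- The limiting probability that the branching process is at most `k`. -/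
def limCDF (s : ℕ → ℝ) (k : ℕ) : ℝ := ⨅ n, chain s n (indLE k)

lemma eq_add_sum_indLE {M : ℕ} {f : ℕ → ℝ} (hf : ∀ k, M ≤ k → f k = f M) (j : ℕ) :
    f j = f M + ∑ k ∈ Finset.range M, (f k - f (k + 1)) * indLE k j := by
  rcases le_or_gt M j with h | h
  · rw [hf j h, Finset.sum_eq_zero, add_zero]
    intro k hk
    have := Finset.mem_range.1 hk
    simp [indLE, show ¬ j ≤ k by omega]
  · rw [← Finset.sum_range_add_sum_Ico _ h.le, Finset.sum_eq_zero, zero_add,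
      Finset.sum_congr rfl (g := fun k => -(f (k + 1) - f k)), Finset.sum_neg_distrib,
      Finset.sum_Ico_sub f h.le]
    · ring
    · intro k hk
      simp [indLE, (Finset.mem_Ico.1 hk).1]
    · intro k hk
      have := Finset.mem_range.1 hk
      simp [indLE, show ¬ j ≤ k by omega]

namespace IsEnv

variable {M : ℕ} {s : ℕ → ℝ}

lemma chain_indLE_mem (h : IsEnv M s) (n k : ℕ) : chain s n (indLE k) ∈ Set.Icc (0 : ℝ) 1 := by
  constructor
  · rw [← h.chain_const 0 n]
    exact h.chain_mono (QuadBdd.const 0) (quadBdd_indLE k)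
      (fun j => by unfold indLE; split_ifs <;> norm_num) n
  · rw [← h.chain_const 1 n]
    exact h.chain_mono (quadBdd_indLE k) (QuadBdd.const 1)
      (fun j => by unfold indLE; split_ifs <;> norm_num) n

lemma antitone_chain_indLE (h : IsEnv M s) (k : ℕ) : Antitone fun n => chain s n (indLE k) := by
  intro a b hab
  have := h.monotone_chain ((quadBdd_indLE k).const_mul (-1))
    (fun a b hab => by have := antitone_indLE k hab; dsimp only; linarith) hab
  simp only [chain_const_mul] at this
  dsimp only
  linarith

lemma bddBelow_chain_indLE (h : IsEnv M s) (k : ℕ) :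
    BddBelow (Set.range fun n => chain s n (indLE k)) :=
  ⟨0, by rintro _ ⟨n, rfl⟩; exact (h.chain_indLE_mem n k).1⟩

lemma tendsto_limCDF (h : IsEnv M s) (k : ℕ) :
    Tendsto (fun n => chain s n (indLE k)) atTop (𝓝 (limCDF s k)) :=
  tendsto_atTop_ciInf (h.antitone_chain_indLE k) (h.bddBelow_chain_indLE k)

lemma limCDF_le (h : IsEnv M s) (n k : ℕ) : limCDF s k ≤ chain s n (indLE k) :=
  ciInf_le (h.bddBelow_chain_indLE k) n

lemma limCDF_mem (h : IsEnv M s) (k : ℕ) : limCDF s k ∈ Set.Icc (0 : ℝ) 1 :=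
  ⟨le_ciInf fun n => (h.chain_indLE_mem n k).1, (h.limCDF_le 0 k).trans (h.chain_indLE_mem 0 k).2⟩

lemma tendsto_chain_of_eventually_const (h : IsEnv M s) {f : ℕ → ℝ}
    (hf : ∀ k, M ≤ k → f k = f M) : Tendsto (fun n => chain s n f) atTop
      (𝓝 (f M + ∑ k ∈ Finset.range M, (f k - f (k + 1)) * limCDF s k)) := by
  have : ∀ n, chain s n f
      = f M + ∑ k ∈ Finset.range M, (f k - f (k + 1)) * chain s n (indLE k) := by
    intro n
    obtain ⟨a, b⟩ := h.chain_sum (Finset.range M) (fun k => f k - f (k + 1)) indLE quadBdd_indLE n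
    rw [← b]
    conv_rhs => rw [← h.chain_const (f M) n]
    rw [← h.chain_add (QuadBdd.const _) a]
    congr 1; funext j; exact eq_add_sum_indLE hf j
  simp only [this]
  exact tendsto_const_nhds.add
    (tendsto_finsetSum _ fun k _ => tendsto_const_nhds.mul (h.tendsto_limCDF k))

end IsEnv

/-- The drift parameter `α` of the environment. -/
def alpha (M : ℕ) (s : ℕ → ℝ) : ℝ := IsEnv.drift M s 0 - 1

/-- The mean displacement of the branching process from `k`. -/
def meanIncr (s : ℕ → ℝ) (k : ℕ) : ℝ := stepOp s (fun j => (j : ℝ)) k - k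

/-- The mean increment of the square of the branching process from `k`, up to its linear part. -/
def sqIncr (M : ℕ) (s : ℕ → ℝ) (k : ℕ) : ℝ :=
  stepOp s (fun j => (j : ℝ) ^ 2) k - (k : ℝ) ^ 2 + 2 * (alpha M s - 1) * k

/-- The squared distance to `{0, …, K}`. -/
def hinge (K j : ℕ) : ℝ := ((j - K : ℕ) : ℝ) ^ 2

lemma hinge_of_le {K j : ℕ} (h : j ≤ K) : hinge K j = 0 := by
  simp [hinge, Nat.sub_eq_zero_of_le h]

lemma hinge_of_ge {K j : ℕ} (h : K ≤ j) : hinge K j = ((j : ℝ) - K) ^ 2 := by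
  rw [hinge, Nat.cast_sub h]

lemma hinge_nonneg (K j : ℕ) : 0 ≤ hinge K j := sq_nonneg _

lemma hinge_le_sq (K j : ℕ) : hinge K j ≤ (j : ℝ) ^ 2 := by
  unfold hinge
  gcongr
  omega

lemma quadBound_hinge (K : ℕ) : QuadBound 1 (hinge K) := fun j => by
  rw [abs_of_nonneg (hinge_nonneg K j)]
  have := hinge_le_sq K j
  have : (0 : ℝ) ≤ j := by positivity
  nlinarith

lemma quadBdd_hinge (K : ℕ) : QuadBdd (hinge K) := ⟨1, quadBound_hinge K⟩

lemma monotone_hinge (K : ℕ) : Monotone (hinge K) := fun a b hab => by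
  unfold hinge
  gcongr

lemma hinge_le_add (K k j : ℕ) :
    hinge K j ≤ hinge K k + 2 * ((k - K : ℕ) : ℝ) * ((j : ℝ) - k) + ((j : ℝ) - k) ^ 2 := by
  rcases le_total k K with h | h
  · rw [hinge_of_le h, Nat.sub_eq_zero_of_le h]
    rcases le_total j K with h' | h'
    · rw [hinge_of_le h']; simp; positivity
    · rw [hinge_of_ge h']
      have a : (k : ℝ) ≤ K := by exact_mod_cast h
      have b : (K : ℝ) ≤ j := by exact_mod_cast h'
      simp
      nlinarith
  · rw [hinge_of_ge h, Nat.cast_sub h]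
    rcases le_total j K with h' | h'
    · rw [hinge_of_le h']
      nlinarith [sq_nonneg ((k : ℝ) - K + (j - k))]
    · rw [hinge_of_ge h']; nlinarith

lemma monotone_hinge_sub {R K : ℕ} (h : R ≤ K) : Monotone fun j => hinge R j - hinge K j := by
  intro a b hab
  have hab' : (a : ℝ) ≤ b := by exact_mod_cast hab
  have hR : (R : ℝ) ≤ K := by exact_mod_cast h
  dsimp only
  rcases le_total a K with h1 | h1
  · rw [hinge_of_le h1]
    rcases le_total b K with h2 | h2
    · rw [hinge_of_le h2]; linarith [monotone_hinge R hab]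
    · rw [hinge_of_ge h2, hinge_of_ge (h.trans h2)]
      have h3 := monotone_hinge R h1
      rw [hinge_of_ge h] at h3
      have : (K : ℝ) ≤ b := by exact_mod_cast h2
      nlinarith
  · rw [hinge_of_ge h1, hinge_of_ge (h.trans h1), hinge_of_ge (h1.trans hab),
      hinge_of_ge (h.trans (h1.trans hab))]
    nlinarith

lemma hinge_sub_le {R K : ℕ} (h : R ≤ K) (j : ℕ) : hinge R j - hinge K j ≤ 2 * K * j := by
  have hR : (R : ℝ) ≤ K := by exact_mod_cast h
  have hR0 : (0 : ℝ) ≤ R := by positivity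
  have hj0 : (0 : ℝ) ≤ j := by positivity
  rcases le_total j K with h1 | h1
  · have h2 := hinge_le_sq R j
    have : (j : ℝ) ≤ K := by exact_mod_cast h1
    rw [hinge_of_le h1]
    nlinarith
  · rw [hinge_of_ge h1, hinge_of_ge (h.trans h1)]
    have : (K : ℝ) ≤ j := by exact_mod_cast h1
    nlinarith

lemma quadBdd_natMin (r : ℕ) : QuadBdd fun j => ((min j r : ℕ) : ℝ) :=
  QuadBdd.natCast.mono fun j => by
    rw [abs_of_nonneg (by positivity), abs_of_nonneg (by positivity)]
    exact_mod_cast min_le_left _ _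

lemma one_add_le_natMin {k r : ℕ} (h : 2 * r < k) :
    1 + (k : ℝ) ≤ 2 * ((k : ℝ) - ((min k r : ℕ) : ℝ)) := by
  rw [min_eq_right (by omega)]
  have : (2 : ℝ) * r + 1 ≤ k := by exact_mod_cast h
  linarith

namespace IsEnv

variable {M : ℕ} {s : ℕ → ℝ}

lemma meanIncr_of_le (h : IsEnv M s) {k : ℕ} (hk : M ≤ k) : meanIncr s k = -alpha M s := by
  rw [meanIncr, stepOp, h.failExp_natCast_eq 0 (k + 1) (by omega), alpha]
  push_cast; ring

lemma meanIncr_succ_le (h : IsEnv M s) (k : ℕ) : meanIncr s (k + 1) ≤ meanIncr s k := by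
  have := (h.failExp_natCast_succ_le 0 (k + 1)).1
  unfold meanIncr stepOp
  push_cast
  linarith

lemma neg_alpha_le_meanIncr (h : IsEnv M s) (k : ℕ) : -alpha M s ≤ meanIncr s k := by
  have ha : Antitone (meanIncr s) := antitone_nat_of_succ_le h.meanIncr_succ_le
  rw [← h.meanIncr_of_le (le_max_left M k)]
  exact ha (le_max_right M k)

lemma meanIncr_le_one (h : IsEnv M s) (k : ℕ) : meanIncr s k ≤ 1 := by
  have := h.failExp_natCast_le 0 (k + 1)
  unfold meanIncr stepOp
  push_cast at this
  linarith

lemma sqIncr_of_le (h : IsEnv M s) {k : ℕ} (hk : M ≤ k) : sqIncr M s k = sqIncr M s M := by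
  obtain ⟨C, hC⟩ := h.exists_failExp_sq_eq 0
  simp only [sqIncr, stepOp, hC (k + 1) (by omega), hC (M + 1) (by omega), alpha]
  push_cast; ring

lemma sqIncr_succ_eq (h : IsEnv M s) {k : ℕ} (hk : meanIncr s (k + 1) = meanIncr s k) :
    sqIncr M s (k + 1) = sqIncr M s k := by
  have e : ∀ l, 0 + (k + 1) ≤ l → s l = 1 / 2 := by
    refine (h.failExp_natCast_succ_le 0 (k + 1)).2 ?_
    unfold meanIncr stepOp at hk
    push_cast at hk
    linarith
  have h' : IsEnv (k + 1) s := ⟨h.half_le, h.lt_one, fun i hi => e i (by omega)⟩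
  have hd : drift (k + 1) s 0 = drift M s 0 := by
    have a := h.failExp_natCast_eq 0 (M + (k + 1)) (by omega)
    have b := h'.failExp_natCast_eq 0 (M + (k + 1)) (by omega)
    linarith
  obtain ⟨C, hC⟩ := h'.exists_failExp_sq_eq 0
  simp only [sqIncr, stepOp, hC (k + 1) (by omega), hC (k + 1 + 1) (by omega), alpha, hd]
  push_cast; ring

lemma quadBdd_sqIncr (h : IsEnv M s) : QuadBdd (sqIncr M s) :=
  ((h.quadBdd_stepOp QuadBdd.sq).sub QuadBdd.sq).add (QuadBdd.natCast.const_mul _)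

lemma chain_succ_sub (h : IsEnv M s) {φ : ℕ → ℝ} (hφ : QuadBdd φ) (n : ℕ) :
    chain s (n + 1) φ - chain s n φ = chain s n (fun k => stepOp s φ k - φ k) := by
  rw [h.chain_sub (h.quadBdd_stepOp hφ) hφ, chain_succ]

lemma tendsto_chain_atTop (h : IsEnv M s) {φ : ℕ → ℝ} (hφ : QuadBdd φ) (hm : Monotone φ) {B : ℝ}
    (hB : ∀ n, chain s n φ ≤ B) : Tendsto (fun n => chain s n φ) atTop (𝓝 (⨆ n, chain s n φ)) :=
  tendsto_atTop_ciSup (h.monotone_chain hφ hm) ⟨B, by rintro _ ⟨n, rfl⟩; exact hB n⟩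

lemma tendsto_chain_incr (h : IsEnv M s) {φ : ℕ → ℝ} (hφ : QuadBdd φ) (hm : Monotone φ) {B : ℝ}
    (hB : ∀ n, chain s n φ ≤ B) :
    Tendsto (fun n => chain s n (fun k => stepOp s φ k - φ k)) atTop (𝓝 0) := by
  have a := h.tendsto_chain_atTop hφ hm hB
  have b := ((tendsto_add_atTop_iff_nat 1).2 a).sub a
  simpa [h.chain_succ_sub hφ] using b

lemma monotone_natCast : Monotone fun j : ℕ => (j : ℝ) := Nat.mono_cast

lemma sum_meanIncr_mul_limCDF (h : IsEnv M s) {B : ℝ} (hB : ∀ n, chain s n (fun j => (j : ℝ)) ≤ B) :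
    ∑ k ∈ Finset.range M, (meanIncr s k - meanIncr s (k + 1)) * limCDF s k = alpha M s := by
  have a := h.tendsto_chain_of_eventually_const (f := meanIncr s)
    fun k hk => by rw [h.meanIncr_of_le hk, h.meanIncr_of_le le_rfl]
  have b := h.tendsto_chain_incr QuadBdd.natCast monotone_natCast hB
  have := tendsto_nhds_unique a b
  rw [h.meanIncr_of_le le_rfl] at this
  linarith

/-- The limiting value of the expectation of `sqIncr`. -/
def sqLim (M : ℕ) (s : ℕ → ℝ) : ℝ :=
  sqIncr M s M + ∑ k ∈ Finset.range M, (sqIncr M s k - sqIncr M s (k + 1)) * limCDF s k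

lemma tendsto_chain_sqIncr (h : IsEnv M s) :
    Tendsto (fun n => chain s n (sqIncr M s)) atTop (𝓝 (sqLim M s)) :=
  h.tendsto_chain_of_eventually_const fun _ hk => h.sqIncr_of_le hk

lemma chain_succ_sub_sq (h : IsEnv M s) (n : ℕ) :
    chain s n (fun k => stepOp s (fun j => (j : ℝ) ^ 2) k - (k : ℝ) ^ 2)
      = chain s n (sqIncr M s) - 2 * (alpha M s - 1) * chain s n (fun j => (j : ℝ)) := by
  rw [← chain_const_mul, ← h.chain_sub h.quadBdd_sqIncr (QuadBdd.natCast.const_mul _)]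
  congr 1; funext k; unfold sqIncr; ring

lemma alpha_mul_chain_le (h : IsEnv M s) (hα : 1 ≤ alpha M s) (n : ℕ) :
    2 * (alpha M s - 1) * chain s n (fun j => (j : ℝ)) ≤ sqLim M s := by
  by_contra! hlt
  set c := 2 * (alpha M s - 1) * chain s n (fun j => (j : ℝ)) - sqLim M s with hc
  have hc0 : 0 < c := by linarith
  obtain ⟨N, hN⟩ := eventually_atTop.1
    (h.tendsto_chain_sqIncr.eventually_lt_const (show sqLim M s < sqLim M s + c / 2 by linarith))
  set m := max n N
  have key : ∀ j, chain s (m + j) (fun k => (k : ℝ) ^ 2)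
      ≤ chain s m (fun k => (k : ℝ) ^ 2) - j * (c / 2) := by
    intro j
    induction j with
    | zero => simp
    | succ j ih =>
      have a := h.chain_succ_sub QuadBdd.sq (m + j)
      rw [h.chain_succ_sub_sq] at a
      have b := hN (m + j) (le_trans (le_max_right _ _) (Nat.le_add_right _ _))
      have d : chain s n (fun j => (j : ℝ)) ≤ chain s (m + j) (fun j => (j : ℝ)) :=
        h.monotone_chain QuadBdd.natCast monotone_natCast
          (le_trans (le_max_left _ _) (Nat.le_add_right _ _))
      have d' := mul_le_mul_of_nonneg_left d (show 0 ≤ 2 * (alpha M s - 1) by linarith)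
      rw [← add_assoc]
      push_cast
      linarith
  obtain ⟨j, hj⟩ := exists_nat_gt (chain s m (fun k => (k : ℝ) ^ 2) / (c / 2))
  rw [div_lt_iff₀ (by linarith)] at hj
  have a := key j
  have b := h.chain_mono (QuadBdd.const 0) QuadBdd.sq (fun j => by positivity) (m + j)
  rw [h.chain_const] at b
  linarith

lemma stepOp_sq_sub_eq (h : IsEnv M s) (k R : ℕ) :
    stepOp s (fun j => ((j : ℝ) - R) ^ 2) k = stepOp s (fun j => (j : ℝ) ^ 2) k
      - 2 * R * stepOp s (fun j => (j : ℝ)) k + (R : ℝ) ^ 2 := by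
  unfold stepOp
  rw [← failExp_const_mul, ← h.failExp_sub QuadBdd.sq (QuadBdd.natCast.const_mul _)]
  conv_rhs => rw [← h.failExp_const ((R : ℝ) ^ 2) 0 (k + 1)]
  rw [← h.failExp_add (QuadBdd.sq.sub (QuadBdd.natCast.const_mul _)) (QuadBdd.const _)]
  congr 1; funext j; ring

lemma quadBdd_sq_sub (R : ℕ) : QuadBdd fun j => ((j : ℝ) - R) ^ 2 := by
  have := (QuadBdd.sq.sub (QuadBdd.natCast.const_mul (2 * (R : ℝ)))).add
    (QuadBdd.const ((R : ℝ) ^ 2))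
  convert this using 2
  ring

lemma stepOp_hinge_sub_le (h : IsEnv M s) (K k : ℕ) :
    stepOp s (hinge K) k - hinge K k ≤ (6 + 2 * |alpha M s|) * (1 + k) := by
  have q1 : QuadBdd fun j => (j : ℝ) - k := QuadBdd.natCast.sub (QuadBdd.const _)
  have a := h.failExp_mono (quadBdd_hinge K)
    (((QuadBdd.const (hinge K k)).add (q1.const_mul (2 * ((k - K : ℕ) : ℝ)))).add
      (quadBdd_sq_sub k)) (hinge_le_add K k) 0 (k + 1)
  rw [h.failExp_add ((QuadBdd.const (hinge K k)).add (q1.const_mul _)) (quadBdd_sq_sub k),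
    h.failExp_add (QuadBdd.const (hinge K k)) (q1.const_mul _), h.failExp_const, failExp_const_mul,
    h.failExp_sub QuadBdd.natCast (QuadBdd.const _), h.failExp_const] at a
  have b := h.stepOp_sq_sub_eq k k
  have c := h.failExp_sq_le 0 (k + 1)
  have d := h.neg_alpha_le_meanIncr k
  have e := h.meanIncr_le_one k
  unfold stepOp at b ⊢
  unfold meanIncr stepOp at d e
  have u1 : ((k - K : ℕ) : ℝ) ≤ k := by exact_mod_cast Nat.sub_le _ _
  have u0 : (0 : ℝ) ≤ ((k - K : ℕ) : ℝ) := by positivity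
  have k0 : (0 : ℝ) ≤ k := by positivity
  have f := le_abs_self (alpha M s)
  have f0 := abs_nonneg (alpha M s)
  push_cast at c
  set E1 := failExp s 0 (k + 1) fun j => (j : ℝ)
  set E2 := failExp s 0 (k + 1) fun j => (j : ℝ) ^ 2
  have g1 : ((k - K : ℕ) : ℝ) * (E1 - k) ≤ k := by nlinarith
  have g2 : (k : ℝ) * (k - E1) ≤ k * |alpha M s| := by
    apply mul_le_mul_of_nonneg_left _ k0; linarith
  nlinarith

lemma stepOp_hinge_sub_le' (h : IsEnv M s) (K r k : ℕ) :
    stepOp s (hinge K) k - hinge K k ≤ stepOp s (hinge K) (2 * r)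
      + 2 * (6 + 2 * |alpha M s|) * ((k : ℝ) - ((min k r : ℕ) : ℝ)) := by
  have hmin : ((min k r : ℕ) : ℝ) ≤ k := by exact_mod_cast min_le_left _ _
  have hA : 0 ≤ 6 + 2 * |alpha M s| := by positivity
  rcases le_or_gt k (2 * r) with hk | hk
  · have a := h.monotone_stepOp (quadBdd_hinge K) (monotone_hinge K) hk
    have b := hinge_nonneg K k
    nlinarith [mul_nonneg hA (sub_nonneg.2 hmin)]
  · have a := h.stepOp_hinge_sub_le K k
    have b := mul_le_mul_of_nonneg_left (one_add_le_natMin hk) hA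
    have c : 0 ≤ stepOp s (hinge K) (2 * r) := by
      have := h.failExp_mono (QuadBdd.const 0) (quadBdd_hinge K) (hinge_nonneg K) 0 (2 * r + 1)
      rwa [h.failExp_const] at this
    linarith

lemma exists_chain_sub_natMin_le (h : IsEnv M s) {B : ℝ}
    (hB : ∀ n, chain s n (fun j => (j : ℝ)) ≤ B) {ε : ℝ} (hε : 0 < ε) :
    ∃ r : ℕ, ∀ᶠ n in atTop,
      chain s n (fun j => (j : ℝ) - ((min j r : ℕ) : ℝ)) ≤ ε := by
  have a := h.tendsto_chain_atTop QuadBdd.natCast monotone_natCast hB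
  set b := ⨆ n, chain s n (fun j => (j : ℝ))
  have hb : ∀ n, chain s n (fun j => (j : ℝ)) ≤ b := fun n =>
    le_ciSup (f := fun n => chain s n (fun j => (j : ℝ))) ⟨B, by rintro _ ⟨n, rfl⟩; exact hB n⟩ n
  obtain ⟨n0, h0⟩ := (a.eventually_const_lt (show b - ε / 2 < b by linarith)).exists
  have c : Tendsto (fun r : ℕ => chain s n0 (fun j => ((min j r : ℕ) : ℝ))) atTop
      (𝓝 (chain s n0 (fun j => (j : ℝ)))) := by
    refine tendsto_chain (s := fun _ => s) (C := 1) (Eventually.of_forall fun _ => h)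
      (fun _ => tendsto_const_nhds) (Eventually.of_forall fun r j => ?_) (fun j => ?_) n0
    · rw [abs_of_nonneg (by positivity)]
      have : ((min j r : ℕ) : ℝ) ≤ j := by exact_mod_cast min_le_left _ _
      have : (0 : ℝ) ≤ j := by positivity
      nlinarith
    · refine tendsto_const_nhds.congr' ?_
      filter_upwards [eventually_ge_atTop j] with r hr
      rw [min_eq_left hr]
  obtain ⟨r, hr⟩ := (c.eventually_const_lt
    (show chain s n0 (fun j => (j : ℝ)) - ε / 2 < _ by linarith)).exists
  refine ⟨r, ?_⟩
  filter_upwards [eventually_ge_atTop n0] with n hn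
  rw [h.chain_sub QuadBdd.natCast (quadBdd_natMin r)]
  have d : chain s n0 (fun j => ((min j r : ℕ) : ℝ)) ≤ chain s n (fun j => ((min j r : ℕ) : ℝ)) :=
    h.monotone_chain (quadBdd_natMin r)
      (fun i j hij => Nat.cast_le.2 (min_le_min_right r hij)) hn
  have := hb n
  linarith

lemma eventually_chain_hinge_incr_le (h : IsEnv M s) {B : ℝ}
    (hB : ∀ n, chain s n (fun j => (j : ℝ)) ≤ B) (R : ℕ) {ε : ℝ} (hε : 0 < ε) :
    ∀ᶠ n in atTop, chain s n (fun k => stepOp s (hinge R) k - hinge R k) ≤ ε := by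
  set A := 2 * (6 + 2 * |alpha M s|) with hA
  have hA0 : 0 < A := by positivity
  obtain ⟨r, hr⟩ := h.exists_chain_sub_natMin_le hB (show 0 < ε / (4 * A) by positivity)
  have t : Tendsto (fun K : ℕ => stepOp s (hinge K) (2 * r)) atTop
      (𝓝 (stepOp s (fun _ => 0) (2 * r))) := by
    refine tendsto_failExp (s := fun _ => s) (C := 1) (Eventually.of_forall fun _ => h)
      (fun _ => tendsto_const_nhds) (Eventually.of_forall quadBound_hinge) (fun j => ?_) _ _
    refine tendsto_const_nhds.congr' ?_
    filter_upwards [eventually_ge_atTop j] with K hK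
    rw [hinge_of_le hK]
  rw [stepOp, h.failExp_const] at t
  obtain ⟨K, hK, hRK⟩ := ((t.eventually_lt_const (show 0 < ε / 4 by linarith)).and
    (eventually_ge_atTop R)).exists
  have qχ := (quadBdd_hinge R).sub (quadBdd_hinge K)
  have inc := h.tendsto_chain_incr qχ (monotone_hinge_sub hRK) (B := 2 * K * B) (fun n => by
    refine (h.chain_mono qχ (QuadBdd.natCast.const_mul (2 * (K : ℝ))) (hinge_sub_le hRK) n).trans ?_
    rw [chain_const_mul]
    exact mul_le_mul_of_nonneg_left (hB n) (by positivity))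
  have qd := QuadBdd.natCast.sub (quadBdd_natMin r)
  filter_upwards [hr, inc.eventually_lt_const (show 0 < ε / 4 by linarith)] with n hn1 hn2
  have c := h.chain_mono ((h.quadBdd_stepOp (quadBdd_hinge K)).sub (quadBdd_hinge K))
    ((QuadBdd.const _).add (qd.const_mul A)) (fun k => h.stepOp_hinge_sub_le' K r k) n
  rw [h.chain_add (QuadBdd.const _) (qd.const_mul A), h.chain_const, chain_const_mul] at c
  have e : chain s n (fun k => stepOp s (hinge R) k - hinge R k)
      = chain s n (fun k => stepOp s (fun j => hinge R j - hinge K j) k - (hinge R k - hinge K k))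
        + chain s n (fun k => stepOp s (hinge K) k - hinge K k) := by
    rw [← h.chain_add ((h.quadBdd_stepOp qχ).sub qχ)
      ((h.quadBdd_stepOp (quadBdd_hinge K)).sub (quadBdd_hinge K))]
    congr 1; funext k
    have : stepOp s (fun j => hinge R j - hinge K j) k
        = stepOp s (hinge R) k - stepOp s (hinge K) k :=
      h.failExp_sub (quadBdd_hinge R) (quadBdd_hinge K) 0 (k + 1)
    rw [this]; ring
  have f : A * chain s n (fun j => (j : ℝ) - ((min j r : ℕ) : ℝ)) ≤ ε / 4 := by
    calc _ ≤ A * (ε / (4 * A)) := mul_le_mul_of_nonneg_left hn1 hA0.le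
      _ = ε / 4 := by field_simp
  rw [e]
  linarith

lemma sqLim_le (h : IsEnv M s) {B : ℝ} (hB : ∀ n, chain s n (fun j => (j : ℝ)) ≤ B) :
    sqLim M s ≤ 2 * (alpha M s - 1) * ⨆ n, chain s n (fun j => (j : ℝ)) := by
  have a := h.tendsto_chain_sqIncr.sub ((h.tendsto_chain_atTop QuadBdd.natCast monotone_natCast
    hB).const_mul (2 * (alpha M s - 1)))
  have : hinge 0 = fun j : ℕ => (j : ℝ) ^ 2 := by funext j; simp [hinge]
  refine sub_nonpos.1 (le_of_forall_pos_le_add fun ε hε => ?_)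
  rw [zero_add]
  refine le_of_tendsto a ?_
  filter_upwards [h.eventually_chain_hinge_incr_le hB 0 hε] with n hn
  rwa [this, h.chain_succ_sub_sq] at hn

lemma failPMF_one_pos (h : IsEnv M s) (i j : ℕ) : 0 < failPMF s i 1 j := by
  have h0 : ∀ i, 0 < s i := fun i => lt_of_lt_of_le (by norm_num) (h.half_le i)
  induction j generalizing i with
  | zero => simpa [failPMF] using h0 i
  | succ j ih =>
    simpa [failPMF] using mul_pos (sub_pos.2 (h.lt_one i)) (ih (i + 1))

lemma stepOp_hinge_ge (h : IsEnv M s) (hα : alpha M s ≤ 1) {R k : ℕ} (hR : M ≤ R) (hk : R ≤ k) :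
    hinge R k ≤ stepOp s (hinge R) k := by
  set ψ : ℕ → ℝ := fun j => ((j : ℝ) - R) ^ 2 - hinge R j with hψ
  have qψ : QuadBdd ψ := (quadBdd_sq_sub R).sub (quadBdd_hinge R)
  have hψ_anti : Monotone fun j => (-1) * ψ j := by
    intro a b hab
    have hab' : (a : ℝ) ≤ b := by exact_mod_cast hab
    simp only [hψ]
    rcases le_total a R with h1 | h1
    · have h1' : (a : ℝ) ≤ R := by exact_mod_cast h1
      rw [hinge_of_le h1]
      rcases le_total b R with h2 | h2
      · have h2' : (b : ℝ) ≤ R := by exact_mod_cast h2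
        rw [hinge_of_le h2]
        nlinarith
      · rw [hinge_of_ge h2]; nlinarith [sq_nonneg ((a : ℝ) - R)]
    · rw [hinge_of_ge h1, hinge_of_ge (h1.trans hab)]; linarith
  have m := h.monotone_stepOp (qψ.const_mul (-1)) hψ_anti hk
  have c : ∀ k, stepOp s (fun j => (-1) * ψ j) k = (-1) * stepOp s ψ k := fun k =>
    failExp_const_mul ψ (-1) 0 (k + 1)
  have e : ∀ k, stepOp s ψ k = stepOp s (fun j => ((j : ℝ) - R) ^ 2) k - stepOp s (hinge R) k :=
    fun k => h.failExp_sub (quadBdd_sq_sub R) (quadBdd_hinge R) 0 (k + 1)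
  have p : 0 ≤ stepOp s (hinge R) R := by
    have := h.failExp_mono (QuadBdd.const 0) (quadBdd_hinge R) (hinge_nonneg R) 0 (R + 1)
    rwa [h.failExp_const] at this
  have m1 := h.meanIncr_of_le hR
  have m2 := h.meanIncr_of_le (hR.trans hk)
  have s1 := h.sqIncr_of_le hR
  have s2 := h.sqIncr_of_le (hR.trans hk)
  rw [c, c, e, e, h.stepOp_sq_sub_eq, h.stepOp_sq_sub_eq] at m
  unfold sqIncr at s1 s2
  unfold meanIncr at m1 m2
  have hk' : (R : ℝ) ≤ k := by exact_mod_cast hk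
  rw [hinge_of_ge hk]
  nlinarith [mul_nonneg (sub_nonneg.2 hα) (sub_nonneg.2 hk')]

lemma one_lt_alpha (h : IsEnv M s) {B : ℝ} (hB : ∀ n, chain s n (fun j => (j : ℝ)) ≤ B) :
    1 < alpha M s := by
  by_contra! hα
  obtain ⟨R, hR⟩ := exists_nat_gt (max (M : ℝ) (max (2 * B) 1))
  have hRM : M ≤ R := by exact_mod_cast ((le_max_left _ _).trans_lt hR).le
  have hRB : 2 * B ≤ R := ((le_max_left _ _).trans (le_max_right _ _)).trans hR.le
  have hR1 : (1 : ℝ) ≤ R := ((le_max_right _ _).trans (le_max_right _ _)).trans hR.le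
  set η := stepOp s (hinge R) 0 with hη
  have hη0 : 0 < η := by
    refine (h.failPMF_one_pos 0 (R + 1)).trans_le ?_
    have := (h.summable' (quadBdd_hinge R) 0 1).le_tsum (R + 1)
      (fun j _ => mul_nonneg (h.failPMF_nonneg _ _ _) (hinge_nonneg _ _))
    simpa [hη, stepOp, failExp, hinge] using this
  obtain ⟨n, hn⟩ := (h.eventually_chain_hinge_incr_le hB R (show 0 < η / 4 by linarith)).exists
  have q := (h.quadBdd_stepOp (quadBdd_hinge R)).sub (quadBdd_hinge R)
  have a := h.chain_mono ((quadBdd_indLE R).const_mul η) q (fun k => by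
    unfold indLE
    split_ifs with hk
    · rw [hinge_of_le hk, mul_one, sub_zero]
      exact h.monotone_stepOp (quadBdd_hinge R) (monotone_hinge R) (Nat.zero_le k)
    · rw [mul_zero, sub_nonneg]
      exact h.stepOp_hinge_ge hα hRM (by omega)) n
  have qi : QuadBdd fun j => (1 : ℝ) - (1 / R : ℝ) * j :=
    (QuadBdd.const 1).sub (QuadBdd.natCast.const_mul _)
  have b := h.chain_mono qi (quadBdd_indLE R) (fun j => by
    unfold indLE
    split_ifs with hj
    · have : (0 : ℝ) ≤ (1 / R : ℝ) * j := by positivity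
      linarith
    · have : (R : ℝ) ≤ j := by exact_mod_cast (not_le.1 hj).le
      rw [sub_nonpos, one_div, ← div_eq_inv_mul, one_le_div (by linarith)]
      exact this) n
  rw [h.chain_sub (QuadBdd.const 1) (QuadBdd.natCast.const_mul _), h.chain_const,
    chain_const_mul] at b
  rw [chain_const_mul] at a
  have c : (1 / R : ℝ) * chain s n (fun j => (j : ℝ)) ≤ 1 / 2 := by
    rw [one_div, ← div_eq_inv_mul, div_le_iff₀ (by linarith)]
    linarith [hB n]
  have d : η * (1 / 2) ≤ η * chain s n (indLE R) := mul_le_mul_of_nonneg_left (by linarith) hη0.le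
  linarith

lemma exists_nonneg_combination (h : IsEnv M s) : ∃ c : ℝ, ∀ k ∈ Finset.range M,
    0 ≤ (sqIncr M s k - sqIncr M s (k + 1)) + c * (meanIncr s k - meanIncr s (k + 1)) := by
  refine ⟨∑ k ∈ Finset.range M, |sqIncr M s k - sqIncr M s (k + 1)|
    / (meanIncr s k - meanIncr s (k + 1)), fun k hk => ?_⟩
  have hg : ∀ k, 0 ≤ meanIncr s k - meanIncr s (k + 1) :=
    fun k => sub_nonneg.2 (h.meanIncr_succ_le k)
  rcases (hg k).eq_or_lt with h0 | h0
  · have := h.sqIncr_succ_eq (k := k) (by linarith)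
    rw [← h0, this]; simp
  · have a := mul_le_mul_of_nonneg_right (Finset.single_le_sum (f := fun k =>
      |sqIncr M s k - sqIncr M s (k + 1)| / (meanIncr s k - meanIncr s (k + 1)))
      (fun k _ => div_nonneg (abs_nonneg _) (hg k)) hk) h0.le
    rw [div_mul_cancel₀ _ h0.ne'] at a
    linarith [neg_abs_le (sqIncr M s k - sqIncr M s (k + 1))]

/-- Upper semicontinuity of the stationary mean of the branching process. -/
theorem eventually_chain_le {ι : Type*} {l : Filter ι} {M : ℕ} {s : ι → ℕ → ℝ} {t : ℕ → ℝ}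
    (hs : ∀ᶠ x in l, IsEnv M (s x)) (ht : IsEnv M t)
    (hst : ∀ i, Tendsto (fun x => s x i) l (𝓝 (t i))) {B : ℝ}
    (hB : ∀ n, chain t n (fun j => (j : ℝ)) ≤ B) {ε : ℝ} (hε : 0 < ε) :
    ∀ᶠ x in l, ∀ n, chain (s x) n (fun j => (j : ℝ)) ≤ B + ε := by
  obtain ⟨c, hc⟩ := ht.exists_nonneg_combination
  have tα : Tendsto (fun x => alpha M (s x)) l (𝓝 (alpha M t)) := by
    unfold alpha drift
    exact (tendsto_finsetSum _ fun i _ => ((hst i).const_mul 2).sub_const 1).sub_const 1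
  have tm : ∀ k, Tendsto (fun x => meanIncr (s x) k) l (𝓝 (meanIncr t k)) := by
    obtain ⟨C, hC⟩ := QuadBdd.natCast
    exact fun k => (tendsto_failExp hs hst (Eventually.of_forall fun _ => hC)
      (fun _ => tendsto_const_nhds) 0 (k + 1)).sub_const _
  have tq : ∀ k, Tendsto (fun x => sqIncr M (s x) k) l (𝓝 (sqIncr M t k)) := by
    obtain ⟨C, hC⟩ := QuadBdd.sq
    exact fun k => ((tendsto_failExp hs hst (Eventually.of_forall fun _ => hC)
      (fun _ => tendsto_const_nhds) 0 (k + 1)).sub_const _).add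
        (((tα.sub_const 1).const_mul 2).mul_const _)
  have ti : ∀ n k, Tendsto (fun x => chain (s x) n (indLE k)) l (𝓝 (chain t n (indLE k))) := by
    intro n k
    obtain ⟨C, hC⟩ := quadBdd_indLE k
    exact tendsto_chain hs hst (Eventually.of_forall fun _ => hC) (fun _ => tendsto_const_nhds) n
  have hα := ht.one_lt_alpha hB
  set w : (ℕ → ℝ) → ℕ → ℝ := fun s k =>
    (sqIncr M s k - sqIncr M s (k + 1)) + c * (meanIncr s k - meanIncr s (k + 1)) with hw
  have tw : ∀ k, Tendsto (fun x => w (s x) k) l (𝓝 (w t k)) := fun k =>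
    ((tq k).sub (tq (k + 1))).add (((tm k).sub (tm (k + 1))).const_mul c)
  have Heq : ∀ {s : ℕ → ℝ} {B : ℝ} (_ : IsEnv M s) (_ : ∀ n, chain s n (fun j => (j : ℝ)) ≤ B),
      sqLim M s = sqIncr M s M + ∑ k ∈ Finset.range M, w s k * limCDF s k - c * alpha M s := by
    intro s B h hB
    rw [← h.sum_meanIncr_mul_limCDF hB, sqLim, Finset.mul_sum, add_sub_assoc,
      ← Finset.sum_sub_distrib]
    congr 1
    refine Finset.sum_congr rfl fun k _ => ?_
    simp only [hw]; ring
  set b := ⨆ n, chain t n (fun j => (j : ℝ)) with hb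
  have hbB : b ≤ B := ciSup_le hB
  have Ht : sqIncr M t M + ∑ k ∈ Finset.range M, w t k * limCDF t k - c * alpha M t
      < 2 * (alpha M t - 1) * (b + ε) := by
    rw [← Heq ht hB]
    refine (ht.sqLim_le hB).trans_lt ?_
    exact mul_lt_mul_of_pos_left (by linarith) (by linarith)
  have tn : Tendsto (fun n => sqIncr M t M + ∑ k ∈ Finset.range M, w t k * chain t n (indLE k)
      - c * alpha M t) atTop
      (𝓝 (sqIncr M t M + ∑ k ∈ Finset.range M, w t k * limCDF t k - c * alpha M t)) :=
    (tendsto_const_nhds.add (tendsto_finsetSum _ fun k _ =>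
      (ht.tendsto_limCDF k).const_mul _)).sub_const _
  obtain ⟨n, hn⟩ := (tn.eventually_lt_const Ht).exists
  have tx : Tendsto (fun x => sqIncr M (s x) M + ∑ k ∈ Finset.range M,
      (w t k * chain (s x) n (indLE k) + |w (s x) k - w t k|) - c * alpha M (s x)
      - 2 * (alpha M (s x) - 1) * (b + ε)) l
      (𝓝 (sqIncr M t M + ∑ k ∈ Finset.range M, (w t k * chain t n (indLE k)
        + |w t k - w t k|) - c * alpha M t - 2 * (alpha M t - 1) * (b + ε))) :=
    (((tq M).add (tendsto_finsetSum _ fun k _ => ((ti n k).const_mul _).add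
      ((tw k).sub_const _).abs)).sub (tα.const_mul c)).sub
      (((tα.sub_const 1).const_mul 2).mul_const _)
  simp only [sub_self, abs_zero, add_zero] at tx
  filter_upwards [hs, tα.eventually_const_lt hα, tx.eventually_lt_const (sub_neg.2 hn)]
    with x hx hαx hlt m
  have hαx' : 0 < 2 * (alpha M (s x) - 1) := by linarith
  have hBx : ∀ n, chain (s x) n (fun j => (j : ℝ)) ≤ sqLim M (s x) / (2 * (alpha M (s x) - 1)) :=
    fun n => by
      rw [le_div_iff₀ hαx', mul_comm]
      exact hx.alpha_mul_chain_le hαx.le n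
  have e := hx.alpha_mul_chain_le hαx.le m
  rw [Heq hx hBx] at e
  have f : ∑ k ∈ Finset.range M, w (s x) k * limCDF (s x) k
      ≤ ∑ k ∈ Finset.range M, (w t k * chain (s x) n (indLE k) + |w (s x) k - w t k|) := by
    refine Finset.sum_le_sum fun k hk => ?_
    have a1 := mul_le_mul_of_nonneg_left (hx.limCDF_le n k) (hc k hk)
    have a2 := hx.limCDF_mem k
    have a3 : (w (s x) k - w t k) * limCDF (s x) k ≤ |w (s x) k - w t k| :=
      calc _ ≤ |w (s x) k - w t k| * limCDF (s x) k :=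
            mul_le_mul_of_nonneg_right (le_abs_self _) a2.1
        _ ≤ _ := mul_le_of_le_one_right (abs_nonneg _) a2.2
    change w t k * limCDF (s x) k ≤ w t k * chain (s x) n (indLE k) at a1
    linarith
  have g : 2 * (alpha M (s x) - 1) * chain (s x) m (fun j => (j : ℝ))
      ≤ 2 * (alpha M (s x) - 1) * (b + ε) := by linarith
  have := le_of_mul_le_mul_left g hαx'
  linarith

end IsEnv

/-- The law of a Boolean variable that is `true` with probability `q`. -/
def coin (q : ℝ) : Measure Bool :=
  ENNReal.ofReal (Set.projIcc 0 1 zero_le_one q) • Measure.dirac true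
    + ENNReal.ofReal (1 - Set.projIcc 0 1 zero_le_one q) • Measure.dirac false

instance (q : ℝ) : IsProbabilityMeasure (coin q) := by
  constructor
  have h := (Set.projIcc (0 : ℝ) 1 zero_le_one q).2
  simp only [coin, Measure.add_apply, Measure.smul_apply, measure_univ, smul_eq_mul, mul_one]
  rw [← ENNReal.ofReal_add h.1 (sub_nonneg.2 h.2)]
  simp

lemma coin_true {q : ℝ} (h0 : 0 ≤ q) (h1 : q ≤ 1) : coin q {true} = ENNReal.ofReal q := by
  simp [coin, Set.projIcc_of_mem zero_le_one (Set.mem_Icc.2 ⟨h0, h1⟩)]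

lemma coin_false {q : ℝ} (h0 : 0 ≤ q) (h1 : q ≤ 1) : coin q {false} = ENNReal.ofReal (1 - q) := by
  simp [coin, Set.projIcc_of_mem zero_le_one (Set.mem_Icc.2 ⟨h0, h1⟩)]

/-- Stacks of arrows: `ω (x, i)` tells whether the `i`-th departure from `x` is to the right. -/
abbrev Arrows := ℤ × ℕ → Bool

/-- The law of independent arrows, the `i`-th arrow at each site pointing to the right with
probability `s i`. -/
def arrowLaw (s : ℕ → ℝ) : Measure Arrows := Measure.infinitePi fun e : ℤ × ℕ => coin (s e.2)

instance (s : ℕ → ℝ) : IsProbabilityMeasure (arrowLaw s) := by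
  unfold arrowLaw; infer_instance

/-- The σ-algebra generated by the arrows with index in `S`. -/
@[reducible] def arrowSigma (S : Set (ℤ × ℕ)) : MeasurableSpace Arrows :=
  ⨆ e ∈ S, MeasurableSpace.comap (fun ω : Arrows => ω e) inferInstance

lemma arrowSigma_le (S : Set (ℤ × ℕ)) : arrowSigma S ≤ MeasurableSpace.pi :=
  iSup₂_le fun e _ => (measurable_pi_apply e).comap_le

lemma arrowSigma_mono {S T : Set (ℤ × ℕ)} (h : S ⊆ T) : arrowSigma S ≤ arrowSigma T :=
  biSup_mono h

lemma measurableSet_arrow {S : Set (ℤ × ℕ)} {e : ℤ × ℕ} (he : e ∈ S) (b : Bool) :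
    MeasurableSet[arrowSigma S] {ω | ω e = b} :=
  le_iSup₂ (f := fun e (_ : e ∈ S) => MeasurableSpace.comap (fun ω : Arrows => ω e) inferInstance)
    e he _ ⟨{b}, measurableSet_singleton b, rfl⟩

lemma arrowLaw_inter (s : ℕ → ℝ) {S T : Set (ℤ × ℕ)} (hST : Disjoint S T) {A B : Set Arrows}
    (hA : MeasurableSet[arrowSigma S] A) (hB : MeasurableSet[arrowSigma T] B) :
    arrowLaw s (A ∩ B) = arrowLaw s A * arrowLaw s B := by
  have h : iIndepFun (fun (e : ℤ × ℕ) (ω : Arrows) => ω e) (arrowLaw s) :=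
    iIndepFun_infinitePi (P := fun e : ℤ × ℕ => coin (s e.2)) (X := fun _ b => b)
      (fun _ => measurable_id)
  exact (Indep_iff _ _ _).1 (indep_iSup_of_disjoint (fun e => (measurable_pi_apply e).comap_le)
    h.iIndep hST) _ _ hA hB

lemma arrowLaw_coord (s : ℕ → ℝ) (e : ℤ × ℕ) (b : Bool) :
    arrowLaw s {ω | ω e = b} = coin (s e.2) {b} := by
  have h := (measurePreserving_eval_infinitePi (fun e : ℤ × ℕ => coin (s e.2)) e).measure_preimage
    (measurableSet_singleton b).nullMeasurableSet
  exact h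

/-- In the trials `i, i + 1, …` of `η`, exactly `j` failures precede the `k`-th success. -/
def Fails (η : ℕ → Bool) : ℕ → ℕ → ℕ → Prop
  | _, 0, 0 => True
  | _, 0, _ + 1 => False
  | i, k + 1, 0 => η i = true ∧ Fails η (i + 1) k 0
  | i, k + 1, j + 1 =>
      (η i = true ∧ Fails η (i + 1) k (j + 1)) ∨ (η i = false ∧ Fails η (i + 1) (k + 1) j)
termination_by _ k j => k + j

lemma Fails.unique {η : ℕ → Bool} {i k j j' : ℕ} (h : Fails η i k j) (hh : Fails η i k j') :
    j = j' := by
  fun_induction Fails η i k j generalizing j' with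
  | case1 => cases j' with
    | zero => rfl
    | succ j' => simp [Fails] at hh
  | case2 => exact h.elim
  | case3 i k ih => cases j' with
    | zero => rfl
    | succ j' =>
      simp only [Fails, h.1] at hh
      simp only [true_and, Bool.true_eq_false, false_and, or_false] at hh
      exact ih h.2 hh
  | case4 i k j ih1 ih2 => cases j' with
    | zero =>
      simp only [Fails] at hh
      rcases h with h | h
      · exact ih1 h.2 hh.2
      · simp [h.1] at hh
    | succ j' =>
      simp only [Fails] at hh
      rcases h with h | h
      · simp only [h.1, true_and, Bool.true_eq_false, false_and, or_false] at hh
        exact ih1 h.2 hh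
      · simp only [h.1, true_and, Bool.false_eq_true, false_and, false_or] at hh
        rw [ih2 h.2 hh]

/-- If `R` of the first `R + L` trials succeed, the last trial being a success, then `L` failures
precede the `R`-th success. -/
lemma fails_of_card {η : ℕ → Bool} {n i R L : ℕ} (hn : R + L = n)
    (hcard : ((Finset.Ico i (i + n)).filter fun l => η l = true).card = R)
    (hlast : 0 < n → η (i + n - 1) = true) : Fails η i R L := by
  induction n generalizing i R L with
  | zero =>
    obtain rfl : R = 0 := by omega
    obtain rfl : L = 0 := by omega
    simp [Fails]
  | succ n ih =>
    have hlast' : 0 < n → η (i + 1 + n - 1) = true := fun _ => by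
      rw [← hlast (by omega)]; congr 1; omega
    have hb := Finset.card_filter_le (Finset.Ico (i + 1) (i + 1 + n)) fun l => η l = true
    rw [Nat.card_Ico] at hb
    rw [← Finset.insert_Ico_add_one_left_eq_Ico (show i < i + (n + 1) by omega),
      Finset.filter_insert, show i + (n + 1) = i + 1 + n by omega] at hcard
    split_ifs at hcard with hi
    · rw [Finset.card_insert_of_notMem (by simp)] at hcard
      obtain ⟨R, rfl⟩ : ∃ R', R = R' + 1 := ⟨R - 1, by omega⟩
      have := ih (R := R) (L := L) (by omega) (Nat.succ_injective hcard) hlast'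
      cases L with
      | zero => simp only [Fails]; exact ⟨hi, this⟩
      | succ L => simp only [Fails]; exact Or.inl ⟨hi, this⟩
    · obtain ⟨L, rfl⟩ : ∃ L', L = L' + 1 := ⟨L - 1, by omega⟩
      have hn0 : 0 < n := by
        by_contra h0
        obtain rfl : n = 0 := by omega
        exact hi (by simpa using hlast (by omega))
      have := ih (R := R) (L := L) (by omega) hcard hlast'
      cases R with
      | zero =>
        obtain ⟨L, rfl⟩ : ∃ L', L = L' + 1 := ⟨L - 1, by omega⟩
        simp [Fails] at this
      | succ R => simp only [Fails]; exact Or.inr ⟨by simpa using hi, this⟩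

/-- The number of failures before the `k`-th success (and `0` if there is no `k`-th success). -/
def numFails (η : ℕ → Bool) (k : ℕ) : ℕ := sInf {j | Fails η 0 k j}

lemma Fails.numFails_eq {η : ℕ → Bool} {k j : ℕ} (h : Fails η 0 k j) : numFails η k = j :=
  (Nat.sInf_mem (s := {j | Fails η 0 k j}) ⟨j, h⟩ : Fails η 0 k _).unique h

lemma measurableSet_fails (x : ℤ) (i k j : ℕ) :
    MeasurableSet[arrowSigma {e | e.1 = x ∧ i ≤ e.2}] {ω | Fails (fun l => ω (x, l)) i k j} := by
  induction h : k + j using Nat.strong_induction_on generalizing i k j with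
  | _ n ih =>
  subst h
  have hS : arrowSigma {e | e.1 = x ∧ i + 1 ≤ e.2} ≤ arrowSigma {e | e.1 = x ∧ i ≤ e.2} :=
    arrowSigma_mono fun e he => ⟨he.1, by have := he.2; omega⟩
  have hm : ∀ b, MeasurableSet[arrowSigma {e | e.1 = x ∧ i ≤ e.2}] {ω : Arrows | ω (x, i) = b} :=
    fun b => measurableSet_arrow
      (show (x, i) ∈ {e : ℤ × ℕ | e.1 = x ∧ i ≤ e.2} from ⟨rfl, le_rfl⟩) b
  rcases k with _ | k
  · rcases j with _ | j
    · simp only [Fails]; exact MeasurableSet.univ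
    · simp only [Fails]; exact @MeasurableSet.empty _ (arrowSigma _)
  · rcases j with _ | j
    · simp only [Fails]
      exact (hm true).inter (hS _ (ih _ (by omega) _ k 0 rfl))
    · simp only [Fails]
      exact ((hm true).inter (hS _ (ih _ (by omega) _ k (j + 1) rfl))).union
        ((hm false).inter (hS _ (ih _ (by omega) _ (k + 1) j rfl)))

namespace IsEnv

variable {M : ℕ} {s : ℕ → ℝ}

lemma arrowLaw_fails (h : IsEnv M s) (x : ℤ) (i k j : ℕ) :
    arrowLaw s {ω | Fails (fun l => ω (x, l)) i k j} = ENNReal.ofReal (failPMF s i k j) := by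
  have inter : ∀ i k j b,
      arrowLaw s ({ω | ω (x, i) = b} ∩ {ω | Fails (fun l => ω (x, l)) (i + 1) k j})
      = coin (s i) {b} * arrowLaw s {ω | Fails (fun l => ω (x, l)) (i + 1) k j} := by
    intro i k j b
    rw [arrowLaw_inter s (S := {(x, i)}) (T := {e | e.1 = x ∧ i + 1 ≤ e.2}) (by simp)
      (measurableSet_arrow (Set.mem_singleton (x, i)) b) (measurableSet_fails x (i + 1) k j),
      arrowLaw_coord]
  have h0 := h.nonneg
  have h1 := h.le_one
  fun_induction failPMF s i k j with
  | case1 => simp [Fails]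
  | case2 => simp [Fails]
  | case3 i k ih =>
    simp only [Fails]
    refine (inter i k 0 true).trans ?_
    rw [coin_true (h0 i) (h1 i), ih, ENNReal.ofReal_mul (h0 i)]
  | case4 i k j ih1 ih2 =>
    simp only [Fails]
    have hd : Disjoint
        ({ω : Arrows | ω (x, i) = true} ∩ {ω | Fails (fun l => ω (x, l)) (i + 1) k (j + 1)})
        ({ω : Arrows | ω (x, i) = false} ∩ {ω | Fails (fun l => ω (x, l)) (i + 1) (k + 1) j}) := by
      rw [Set.disjoint_left]
      rintro ω ⟨a, _⟩ ⟨b, _⟩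
      simp only [Set.mem_ofPred_eq] at a b
      simp [a] at b
    refine (measure_union hd ?_).trans ?_
    · exact (arrowSigma_le _ _ (measurableSet_arrow (Set.mem_singleton (x, i)) false)).inter
        (arrowSigma_le _ _ (measurableSet_fails x (i + 1) (k + 1) j))
    rw [inter, inter, coin_true (h0 i) (h1 i), coin_false (h0 i) (h1 i), ih1, ih2,
      ENNReal.ofReal_add (mul_nonneg (h0 i) (h.failPMF_nonneg _ _ _))
        (mul_nonneg (sub_nonneg.2 (h1 i)) (h.failPMF_nonneg _ _ _)),
      ENNReal.ofReal_mul (h0 i), ENNReal.ofReal_mul (sub_nonneg.2 (h1 i))]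

lemma ae_exists_fails (h : IsEnv M s) (x : ℤ) (k : ℕ) :
    ∀ᵐ ω ∂arrowLaw s, ∃ j, Fails (fun l => ω (x, l)) 0 k j := by
  have hm : ∀ j, MeasurableSet {ω : Arrows | Fails (fun l => ω (x, l)) 0 k j} := fun j =>
    arrowSigma_le _ _ (measurableSet_fails x 0 k j)
  have hU : arrowLaw s (⋃ j, {ω | Fails (fun l => ω (x, l)) 0 k j}) = 1 := by
    rw [measure_iUnion (fun a b hab => Set.disjoint_left.2 fun ω ha hb => hab (ha.unique hb)) hm]
    simp only [h.arrowLaw_fails]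
    have hs : Summable fun j => failPMF s 0 k j := by
      simpa using h.summable' (QuadBdd.const 1) 0 k
    rw [← ENNReal.ofReal_tsum_of_nonneg (h.failPMF_nonneg 0 k) hs]
    have h1 : ∑' j, failPMF s 0 k j = 1 := by simpa [failExp] using h.failExp_one 0 k
    simp [h1]
  have := (prob_compl_eq_zero_iff (MeasurableSet.iUnion hm)).2 hU
  rw [ae_iff]
  convert this using 2
  ext ω; simp

lemma arrowLaw_numFails (h : IsEnv M s) (x : ℤ) (k j : ℕ) :
    arrowLaw s {ω | numFails (fun l => ω (x, l)) k = j} = ENNReal.ofReal (failPMF s 0 k j) := by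
  rw [← h.arrowLaw_fails x 0 k j]
  refine measure_congr ?_
  filter_upwards [h.ae_exists_fails x k] with ω hω
  obtain ⟨j', hj'⟩ := hω
  refine propext ⟨fun e => ?_, fun e => e.numFails_eq⟩
  have e' : numFails (fun l => ω (x, l)) k = j := e
  rw [hj'.numFails_eq] at e'
  exact e' ▸ hj'

end IsEnv

lemma measurableSet_numFails (x : ℤ) (k j : ℕ) :
    MeasurableSet[arrowSigma {e | e.1 = x}] {ω | numFails (fun l => ω (x, l)) k = j} := by
  have hm : ∀ j, MeasurableSet[arrowSigma {e | e.1 = x}]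
      {ω : Arrows | Fails (fun l => ω (x, l)) 0 k j} :=
    fun j => arrowSigma_mono (fun e he => he.1) _ (measurableSet_fails x 0 k j)
  have e : {ω : Arrows | numFails (fun l => ω (x, l)) k = j}
      = {ω | Fails (fun l => ω (x, l)) 0 k j}
        ∪ ((⋃ j', {ω | Fails (fun l => ω (x, l)) 0 k j'})ᶜ ∩ {_ω | j = 0}) := by
    ext ω
    simp only [Set.mem_ofPred_eq, Set.mem_union, Set.mem_inter_iff, Set.mem_compl_iff,
      Set.mem_iUnion]
    constructor
    · intro hj
      by_cases hex : ∃ j', Fails (fun l => ω (x, l)) 0 k j'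
      · obtain ⟨j', hj'⟩ := hex
        rw [hj'.numFails_eq] at hj
        exact Or.inl (hj ▸ hj')
      · refine Or.inr ⟨hex, ?_⟩
        rw [← hj, numFails, Nat.sInf_eq_zero]
        refine Or.inr (Set.eq_empty_iff_forall_notMem.2 fun j' hj' => hex ⟨j', hj'⟩)
    · rintro (hj | ⟨hex, rfl⟩)
      · exact hj.numFails_eq
      · rw [numFails, Nat.sInf_eq_zero]
        refine Or.inr (Set.eq_empty_iff_forall_notMem.2 fun j' hj' => hex ⟨j', hj'⟩)
  rw [e]
  exact (hm j).union ((MeasurableSet.iUnion hm).compl.inter (MeasurableSet.const _))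

/-- The branching process read off from the arrows at `x, …, x + r - 1`, the generation `r` being
that of the site `x`. -/
def downcross (ω : Arrows) : ℤ → ℕ → ℕ
  | _, 0 => 0
  | x, r + 1 => numFails (fun l => ω (x, l)) (downcross ω (x + 1) r + 1)

lemma setOf_downcross_succ (x : ℤ) (r j : ℕ) :
    {ω | downcross ω x (r + 1) = j}
      = ⋃ k, ({ω | numFails (fun l => ω (x, l)) (k + 1) = j}
          ∩ {ω | downcross ω (x + 1) r = k}) := by
  ext ω
  simp [downcross]

lemma measurableSet_downcross (x : ℤ) (r j : ℕ) :
    MeasurableSet[arrowSigma {e | x ≤ e.1}] {ω | downcross ω x r = j} := by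
  induction r generalizing x j with
  | zero => simp only [downcross]; exact MeasurableSet.const _
  | succ r ih =>
    rw [setOf_downcross_succ]
    refine MeasurableSet.iUnion fun k => ?_
    exact (arrowSigma_mono (fun e he => (show e.1 = x from he).ge) _
        (measurableSet_numFails x (k + 1) j)).inter
      (arrowSigma_mono (fun e (he : x + 1 ≤ e.1) => show x ≤ e.1 by omega) _ (ih (x + 1) k))

lemma measurable_downcross (x : ℤ) (r : ℕ) : Measurable fun ω : Arrows => downcross ω x r :=
  measurable_to_countable' fun j => arrowSigma_le _ _ (measurableSet_downcross x r j)

lemma lintegral_comp_nat {Ω : Type*} [MeasurableSpace Ω] (P : Measure Ω) {Y : Ω → ℕ}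
    (hY : Measurable Y) (f : ℕ → ℝ≥0∞) :
    ∫⁻ ω, f (Y ω) ∂P = ∑' j, f j * P {ω | Y ω = j} := by
  rw [← lintegral_map (f := f) (by fun_prop) hY, lintegral_countable']
  refine tsum_congr fun j => ?_
  rw [Measure.map_apply hY (measurableSet_singleton j)]
  rfl

theorem IsEnv.lintegral_downcross {M : ℕ} {s : ℕ → ℝ} (h : IsEnv M s) {φ : ℕ → ℝ}
    (hφ : QuadBdd φ) (h0 : ∀ j, 0 ≤ φ j) (x : ℤ) (r : ℕ) :
    ∫⁻ ω, ENNReal.ofReal (φ (downcross ω x r)) ∂arrowLaw s = ENNReal.ofReal (chain s r φ) := by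
  induction r generalizing x φ with
  | zero => simp [downcross, chain_zero]
  | succ r ih =>
    have hstep : ∀ k, ENNReal.ofReal (stepOp s φ k)
        = ∑' j, ENNReal.ofReal (φ j) * ENNReal.ofReal (failPMF s 0 (k + 1) j) := by
      intro k
      rw [stepOp, failExp, ENNReal.ofReal_tsum_of_nonneg
        (fun j => mul_nonneg (h.failPMF_nonneg _ _ _) (h0 j)) (h.summable' hφ 0 (k + 1))]
      refine tsum_congr fun j => ?_
      rw [ENNReal.ofReal_mul (h.failPMF_nonneg _ _ _), mul_comm]
    have hs0 : ∀ k, 0 ≤ stepOp s φ k := fun k => by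
      have := h.failExp_mono (QuadBdd.const 0) hφ h0 0 (k + 1)
      rwa [h.failExp_const] at this
    rw [chain_succ, ← ih (h.quadBdd_stepOp hφ) hs0 (x + 1),
      lintegral_comp_nat _ (measurable_downcross (x + 1) r)
        (fun k => ENNReal.ofReal (stepOp s φ k)),
      lintegral_comp_nat _ (measurable_downcross x (r + 1)) (fun j => ENNReal.ofReal (φ j))]
    have hP : ∀ j, arrowLaw s {ω | downcross ω x (r + 1) = j}
        = ∑' k, ENNReal.ofReal (failPMF s 0 (k + 1) j)
          * arrowLaw s {ω | downcross ω (x + 1) r = k} := by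
      intro j
      rw [setOf_downcross_succ, measure_iUnion]
      · refine tsum_congr fun k => ?_
        rw [arrowLaw_inter s (S := {e | e.1 = x}) (T := {e | x + 1 ≤ e.1})
          (Set.disjoint_left.2 fun e (he : e.1 = x) (he' : x + 1 ≤ e.1) => by omega)
          (measurableSet_numFails x (k + 1) j) (measurableSet_downcross (x + 1) r k),
          h.arrowLaw_numFails]
      · intro a b hab
        exact Set.disjoint_left.2 fun ω ha hb => hab (ha.2.symm.trans hb.2)
      · exact fun k => (arrowSigma_le _ _ (measurableSet_numFails x (k + 1) j)).inter
          (arrowSigma_le _ _ (measurableSet_downcross (x + 1) r k))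
    simp only [hP, hstep, ← ENNReal.tsum_mul_left, ← ENNReal.tsum_mul_right]
    rw [ENNReal.tsum_comm]
    simp only [mul_assoc]

section Walk

/-- The position of the walk together with the numbers of its departures to the right and to the
left from each site. -/
structure WalkState where
  pos : ℤ
  ups : ℤ → ℕ
  downs : ℤ → ℕ

/-- The state of the walk driven by the arrows `ω` after `n` steps. -/
def walkState (ω : Arrows) : ℕ → WalkState
  | 0 => ⟨0, fun _ => 0, fun _ => 0⟩
  | n + 1 =>
    let w := walkState ω n
    if ω (w.pos, w.ups w.pos + w.downs w.pos) = true then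
      ⟨w.pos + 1, Function.update w.ups w.pos (w.ups w.pos + 1), w.downs⟩
    else ⟨w.pos - 1, w.ups, Function.update w.downs w.pos (w.downs w.pos + 1)⟩

/-- The walk driven by the arrows `ω`. -/
def walk (n : ℕ) (ω : Arrows) : ℤ := (walkState ω n).pos

/-- The number of departures to the right from `x` before time `n`. -/
def ups (ω : Arrows) (n : ℕ) (x : ℤ) : ℕ := (walkState ω n).ups x

/-- The number of departures to the left from `x` before time `n`. -/
def downs (ω : Arrows) (n : ℕ) (x : ℤ) : ℕ := (walkState ω n).downs x

variable {ω : Arrows}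

lemma walk_zero (ω : Arrows) : walk 0 ω = 0 := rfl

lemma ups_zero (ω : Arrows) (x : ℤ) : ups ω 0 x = 0 := rfl

lemma downs_zero (ω : Arrows) (x : ℤ) : downs ω 0 x = 0 := rfl

lemma step_cases (ω : Arrows) (n : ℕ) :
    (ω (walk n ω, ups ω n (walk n ω) + downs ω n (walk n ω)) = true ∧
      walk (n + 1) ω = walk n ω + 1 ∧
      (∀ x, ups ω (n + 1) x = ups ω n x + if x = walk n ω then 1 else 0) ∧
      ∀ x, downs ω (n + 1) x = downs ω n x) ∨
    (ω (walk n ω, ups ω n (walk n ω) + downs ω n (walk n ω)) = false ∧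
      walk (n + 1) ω = walk n ω - 1 ∧
      (∀ x, ups ω (n + 1) x = ups ω n x) ∧
      ∀ x, downs ω (n + 1) x = downs ω n x + if x = walk n ω then 1 else 0) := by
  by_cases h : ω (walk n ω, ups ω n (walk n ω) + downs ω n (walk n ω)) = true
  · have e : walkState ω (n + 1) = ⟨walk n ω + 1,
        Function.update (walkState ω n).ups (walk n ω) (ups ω n (walk n ω) + 1),
        (walkState ω n).downs⟩ := if_pos h
    refine Or.inl ⟨h, by rw [walk, e], fun x => ?_, fun x => by rw [downs, e, downs]⟩
    rw [ups, e]
    dsimp only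
    by_cases hx : x = walk n ω
    · subst hx; simp
    · rw [Function.update_of_ne hx, if_neg hx]; rfl
  · have e : walkState ω (n + 1) = ⟨walk n ω - 1, (walkState ω n).ups,
        Function.update (walkState ω n).downs (walk n ω) (downs ω n (walk n ω) + 1)⟩ := if_neg h
    refine Or.inr ⟨by simpa using h, by rw [walk, e], fun x => by rw [ups, e, ups], fun x => ?_⟩
    rw [downs, e]
    dsimp only
    by_cases hx : x = walk n ω
    · subst hx; simp
    · rw [Function.update_of_ne hx, if_neg hx]; rfl

lemma walk_succ_eq_or (ω : Arrows) (n : ℕ) :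
    walk (n + 1) ω = walk n ω + 1 ∨ walk (n + 1) ω = walk n ω - 1 := by
  rcases step_cases ω n with h | h
  · exact Or.inl h.2.1
  · exact Or.inr h.2.1

lemma ups_add_downs (ω : Arrows) (n : ℕ) (x : ℤ) :
    ups ω n x + downs ω n x = ((Finset.range n).filter fun i => walk i ω = x).card := by
  induction n with
  | zero => simp [ups_zero, downs_zero]
  | succ n ih =>
    rw [Finset.range_add_one, Finset.filter_insert]
    by_cases hx : x = walk n ω
    · rw [if_pos hx.symm, Finset.card_insert_of_notMem (by simp)]
      rcases step_cases ω n with ⟨-, -, h1, h2⟩ | ⟨-, -, h1, h2⟩ <;>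
      · rw [h1, h2, if_pos hx]
        omega
    · rw [if_neg (Ne.symm hx)]
      rcases step_cases ω n with ⟨-, -, h1, h2⟩ | ⟨-, -, h1, h2⟩ <;>
      · rw [h1, h2, if_neg hx]
        omega

lemma ups_sub_downs (ω : Arrows) (n : ℕ) (x : ℤ) :
    (ups ω n x : ℤ) - downs ω n (x + 1)
      = (if x < walk n ω then 1 else 0) - if x < 0 then 1 else 0 := by
  induction n with
  | zero => rw [ups_zero, downs_zero, walk_zero, sub_self]; simp
  | succ n ih =>
    rcases step_cases ω n with ⟨-, h0, h1, h2⟩ | ⟨-, h0, h1, h2⟩ <;>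
    · rw [h0, h1, h2]
      push_cast
      split_ifs at ih ⊢ <;> omega

lemma card_true_arrows (ω : Arrows) (n : ℕ) (x : ℤ) :
    ((Finset.Ico 0 (0 + (ups ω n x + downs ω n x))).filter fun l => ω (x, l) = true).card
      = ups ω n x := by
  simp only [zero_add, Nat.Ico_zero_eq_range]
  induction n with
  | zero => simp [ups_zero, downs_zero]
  | succ n ih =>
    rcases step_cases ω n with ⟨h, h0, h1, h2⟩ | ⟨h, h0, h1, h2⟩ <;> rw [h1, h2]
    · split_ifs with hx
      · subst hx
        rw [add_right_comm, Finset.range_add_one, Finset.filter_insert, if_pos h,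
          Finset.card_insert_of_notMem (by simp), ih]
      · exact ih
    · split_ifs with hx
      · subst hx
        rw [← add_assoc, Finset.range_add_one, Finset.filter_insert, if_neg (by simp [h]), ih]
      · exact ih

lemma last_arrow (ω : Arrows) (n : ℕ) {x : ℤ} (hx : x < walk n ω)
    (h0 : 0 < ups ω n x + downs ω n x) :
    ω (x, 0 + (ups ω n x + downs ω n x) - 1) = true := by
  rw [zero_add]
  induction n with
  | zero => simp [ups_zero, downs_zero] at h0
  | succ n ih =>
    rcases step_cases ω n with ⟨h, e0, e1, e2⟩ | ⟨h, e0, e1, e2⟩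
    · rw [e1, e2] at h0 ⊢
      rw [e0] at hx
      split_ifs at h0 ⊢ with hxw
      · subst hxw
        rw [show ups ω n (walk n ω) + 1 + downs ω n (walk n ω) - 1
          = ups ω n (walk n ω) + downs ω n (walk n ω) by omega]
        exact h
      · exact ih (by omega) h0
    · rw [e1, e2] at h0 ⊢
      rw [e0] at hx
      rw [if_neg (by omega)] at h0 ⊢
      exact ih (by omega) h0

lemma fails_downs (ω : Arrows) (n : ℕ) {x : ℤ} (hx0 : 0 ≤ x) (hx : x < walk n ω) :
    Fails (fun l => ω (x, l)) 0 (downs ω n (x + 1) + 1) (downs ω n x) := by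
  have h := ups_sub_downs ω n x
  rw [if_pos hx, if_neg (by omega)] at h
  have e : ups ω n x = downs ω n (x + 1) + 1 := by omega
  rw [← e]
  exact fails_of_card rfl (card_true_arrows ω n x) (last_arrow ω n hx)

/-- `t` is the hitting time of `m`. -/
def IsHit (ω : Arrows) (m t : ℕ) : Prop := walk t ω = m ∧ ∀ i < t, walk i ω < m

lemma IsHit.downs_eq_zero {m t : ℕ} (h : IsHit ω m t) : downs ω t m = 0 := by
  have := ups_add_downs ω t m
  rw [Finset.filter_eq_empty_iff.2 fun i hi => (h.2 i (Finset.mem_range.1 hi)).ne,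
    Finset.card_empty] at this
  omega

lemma IsHit.downs_eq {m t : ℕ} (h : IsHit ω m t) {y : ℕ} (hy : y ≤ m) :
    downs ω t y = downcross ω y (m - y) := by
  induction hr : m - y generalizing y with
  | zero =>
    obtain rfl : y = m := by omega
    rw [h.downs_eq_zero]; rfl
  | succ r ih =>
    have a := ih (y := y + 1) (by omega) (by omega)
    have b := fails_downs ω t (x := y) (by omega) (by rw [h.1]; exact_mod_cast (by omega : y < m))
    push_cast at a
    rw [a] at b
    rw [downcross, b.numFails_eq]

/-- The total number of left departures from `{0, …, m - 1}` before `m` is hit. -/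
def totalDown (ω : Arrows) (m : ℕ) : ℕ := ∑ y ∈ Finset.range m, downcross ω y (m - y)

/-- The time spent on the negative half-line before time `t`. -/
def negTime (ω : Arrows) (t : ℕ) : ℕ := ((Finset.range t).filter fun i => walk i ω < 0).card

lemma IsHit.eq {m t : ℕ} (h : IsHit ω m t) :
    t + downs ω t 0 = negTime ω t + m + 2 * totalDown ω m := by
  have hS : totalDown ω m = ∑ y ∈ Finset.range m, downs ω t y :=
    Finset.sum_congr rfl fun y hy => (h.downs_eq (Finset.mem_range.1 hy).le).symm
  have h1 : t = negTime ω t + ((Finset.range t).filter fun i => ¬ walk i ω < 0).card := by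
    rw [negTime, Finset.card_filter_add_card_filter_not, Finset.card_range]
  have h2 : ((Finset.range t).filter fun i => ¬ walk i ω < 0).card
      = ∑ y ∈ Finset.range m, (ups ω t y + downs ω t y) := by
    rw [Finset.card_eq_sum_card_fiberwise (f := fun i => (walk i ω).toNat) (t := Finset.range m)]
    · refine Finset.sum_congr rfl fun y _ => ?_
      rw [ups_add_downs, Finset.filter_filter]
      congr 1
      refine Finset.filter_congr fun i _ => ?_
      omega
    · intro i hi
      have hi' := Finset.mem_filter.1 hi
      have := h.2 i (Finset.mem_range.1 hi'.1)
      have := hi'.2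
      exact Finset.mem_coe.2 (Finset.mem_range.2 (by dsimp only; omega))
  have h3 : ∑ y ∈ Finset.range m, ups ω t y + downs ω t 0
      = m + ∑ y ∈ Finset.range m, downs ω t y := by
    have a : ∀ y ∈ Finset.range m, ups ω t y = downs ω t ((y + 1 : ℕ) : ℤ) + 1 := by
      intro y hy
      have hy' := Finset.mem_range.1 hy
      have := ups_sub_downs ω t y
      rw [if_pos (by rw [h.1]; exact_mod_cast hy'), if_neg (by omega)] at this
      push_cast
      omega
    have b := Finset.sum_range_succ' (fun y : ℕ => downs ω t y) m
    rw [Finset.sum_range_succ, h.downs_eq_zero] at b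
    rw [Finset.sum_congr rfl a, Finset.sum_add_distrib]
    simp only [Finset.sum_const, Finset.card_range, smul_eq_mul, mul_one]
    simp only [Nat.cast_zero] at b
    omega
  rw [Finset.sum_add_distrib] at h2
  omega

lemma IsHit.add_two_mul_le {m t : ℕ} (h : IsHit ω m t) : m + 2 * totalDown ω m ≤ t := by
  have a := h.eq
  have b := ups_sub_downs ω t (-1)
  rw [if_pos (by rw [h.1]; omega), if_pos (by omega)] at b
  have c := ups_add_downs ω t (-1)
  have d : ((Finset.range t).filter fun i => walk i ω = -1).card ≤ negTime ω t :=
    Finset.card_le_card fun i hi => by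
      rw [Finset.mem_filter] at hi ⊢
      exact ⟨hi.1, by omega⟩
  simp only [neg_add_cancel] at b
  omega

lemma IsHit.le_add {m t : ℕ} (h : IsHit ω m t) : t ≤ negTime ω t + m + 2 * totalDown ω m := by
  have := h.eq
  omega

lemma exists_isHit (h : ∀ m : ℕ, ∃ n, (m : ℤ) ≤ walk n ω) (m : ℕ) : ∃ t, IsHit ω m t := by
  classical
  refine ⟨Nat.find (h m), ?_, fun i hi => not_le.1 (Nat.find_min (h m) hi)⟩
  have hs := Nat.find_spec (h m)
  rcases ht : Nat.find (h m) with _ | t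
  · rw [ht, walk_zero] at hs
    rw [walk_zero]; omega
  · rw [ht] at hs
    have := Nat.find_min (h m) (show t < Nat.find (h m) by omega)
    rcases walk_succ_eq_or ω t with e | e <;> omega

lemma walk_le (ω : Arrows) (n : ℕ) : |walk n ω| ≤ n := by
  induction n with
  | zero => simp [walk_zero]
  | succ n ih =>
    rw [abs_le] at ih ⊢
    push_cast
    rcases walk_succ_eq_or ω n with e | e <;> omega

lemma IsHit.le {m t : ℕ} (h : IsHit ω m t) : m ≤ t := by
  have := abs_le.1 (walk_le ω t)
  rw [h.1] at this
  omega

lemma IsHit.mono {m m' t t' : ℕ} (h : IsHit ω m t) (h' : IsHit ω m' t') (hm : m ≤ m') : t ≤ t' := by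
  by_contra! hlt
  have := h.2 t' hlt
  rw [h'.1] at this
  omega

lemma monotone_downs (ω : Arrows) (x : ℤ) : Monotone fun n => downs ω n x :=
  monotone_nat_of_le_succ fun n => by
    rcases step_cases ω n with ⟨-, -, -, h⟩ | ⟨-, -, -, h⟩
    · exact (h x).ge
    · rw [h]; omega

/-- If the number of left departures from `0` is bounded, so is the time spent on the negative
half-line. -/
lemma exists_negTime_le {τ : ℕ → ℕ} (hτ : ∀ m, IsHit ω m (τ m)) {B : ℕ}
    (hB : ∀ m, downcross ω 0 m ≤ B) : ∃ N, ∀ t, negTime ω t ≤ N := by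
  have hd : ∀ m, downs ω (τ m) 0 ≤ B := fun m => by
    have := (hτ m).downs_eq (Nat.zero_le m)
    simp only [Nat.cast_zero, Nat.sub_zero] at this
    rw [this]
    exact hB m
  obtain ⟨m, hm⟩ : ∃ m, ∀ m', downs ω (τ m') 0 ≤ downs ω (τ m) 0 := by
    have hbdd : BddAbove (Set.range fun m => downs ω (τ m) 0) :=
      ⟨B, by rintro _ ⟨m, rfl⟩; exact hd m⟩
    obtain ⟨m, hm⟩ := Nat.sSup_mem (Set.range_nonempty fun m => downs ω (τ m) 0) hbdd
    exact ⟨m, fun m' => (le_csSup hbdd (Set.mem_range_self m')).trans hm.ge⟩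
  have hall : ∀ n, downs ω n 0 ≤ downs ω (τ m) 0 := fun n =>
    (monotone_downs ω 0 ((hτ n).le)).trans (hm n)
  have hpos : ∀ n, τ m ≤ n → 0 ≤ walk n ω := by
    intro n hn
    induction n, hn using Nat.le_induction with
    | base => rw [(hτ m).1]; omega
    | succ n hn ih =>
      rcases step_cases ω n with ⟨-, e, -, -⟩ | ⟨-, e, -, h⟩
      · omega
      · have h0 := h 0
        have := hall (n + 1)
        have : downs ω (τ m) 0 ≤ downs ω n 0 := monotone_downs ω 0 hn
        split_ifs at h0 with hx
        · omega
        · omega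
  refine ⟨τ m, fun t => ?_⟩
  calc negTime ω t ≤ (Finset.range (τ m)).card := Finset.card_le_card fun i hi => by
        have hi' := Finset.mem_filter.1 hi
        rw [Finset.mem_range]
        by_contra! hc
        have := hpos i hc
        omega
    _ = τ m := Finset.card_range _

end Walk

/-- The walk follows `x` up to time `n`. -/
def followEvent (n : ℕ) (x : ℕ → ℤ) : Set Arrows := {ω | ∀ k ≤ n, walk k ω = x k}

/-- The number of visits of `x` to `x n` before time `n`. -/
def visits (n : ℕ) (x : ℕ → ℤ) : ℕ := ((Finset.range n).filter fun i => x i = x n).card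

lemma ups_add_downs_of_mem {n : ℕ} {x : ℕ → ℤ} {ω : Arrows} (h : ω ∈ followEvent n x) :
    ups ω n (x n) + downs ω n (x n) = visits n x := by
  rw [ups_add_downs, visits]
  congr 1
  refine Finset.filter_congr fun i hi => ?_
  rw [h i (Finset.mem_range.1 hi).le]

lemma walk_succ_of_mem {n : ℕ} {x : ℕ → ℤ} {ω : Arrows} (h : ω ∈ followEvent n x) :
    walk (n + 1) ω = if ω (x n, visits n x) = true then x n + 1 else x n - 1 := by
  have hn : walk n ω = x n := h n le_rfl
  have hc := step_cases ω n
  rw [hn, ups_add_downs_of_mem h] at hc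
  rcases hc with ⟨h1, h2, -⟩ | ⟨h1, h2, -⟩
  · rw [h2, if_pos h1]
  · rw [h2, if_neg (by simp [h1])]

lemma followEvent_inter_up (n : ℕ) (x : ℕ → ℤ) :
    followEvent n x ∩ {ω | walk (n + 1) ω = x n + 1}
      = followEvent n x ∩ {ω | ω (x n, visits n x) = true} := by
  ext ω
  refine and_congr_right fun h => ?_
  have := walk_succ_of_mem h
  show walk (n + 1) ω = x n + 1 ↔ ω (x n, visits n x) = true
  rw [this]
  split_ifs with h1 <;> simp [h1]
  omega

lemma followEvent_inter_down (n : ℕ) (x : ℕ → ℤ) :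
    followEvent n x ∩ {ω | walk (n + 1) ω = x n - 1}
      = followEvent n x ∩ {ω | ω (x n, visits n x) = false} := by
  ext ω
  refine and_congr_right fun h => ?_
  have := walk_succ_of_mem h
  show walk (n + 1) ω = x n - 1 ↔ ω (x n, visits n x) = false
  rw [this]
  split_ifs with h1 <;> simp [h1]
  omega

lemma followEvent_succ (n : ℕ) (x : ℕ → ℤ) :
    followEvent (n + 1) x = followEvent n x ∩ {ω | walk (n + 1) ω = x (n + 1)} := by
  ext ω
  constructor
  · exact fun h => ⟨fun k hk => h k (by omega), h (n + 1) le_rfl⟩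
  · rintro ⟨h1, h2⟩ k hk
    rcases Nat.lt_or_ge k (n + 1) with h | h
    · exact h1 k (by omega)
    · obtain rfl : k = n + 1 := by omega
      exact h2

lemma measurableSet_followEvent (n : ℕ) (x : ℕ → ℤ) :
    MeasurableSet[arrowSigma {e | e.2 < ((Finset.range n).filter fun i => x i = e.1).card}]
      (followEvent n x) := by
  induction n with
  | zero =>
    by_cases h : x 0 = 0
    · convert @MeasurableSet.univ _ (arrowSigma _)
      exact Set.eq_univ_of_forall fun ω k hk => by
        obtain rfl : k = 0 := by omega
        rw [walk_zero, h]
    · convert @MeasurableSet.empty _ (arrowSigma _)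
      exact Set.eq_empty_of_forall_notMem fun ω hω => h (hω 0 le_rfl).symm
  | succ n ih =>
    have hS : arrowSigma {e | e.2 < ((Finset.range n).filter fun i => x i = e.1).card}
        ≤ arrowSigma {e | e.2 < ((Finset.range (n + 1)).filter fun i => x i = e.1).card} :=
      arrowSigma_mono fun e he => lt_of_lt_of_le he
        (Finset.card_le_card (Finset.filter_subset_filter _
          (Finset.range_subset_range.2 (Nat.le_succ n))))
    have he : (x n, visits n x)
        ∈ {e : ℤ × ℕ | e.2 < ((Finset.range (n + 1)).filter fun i => x i = e.1).card} := by
      show visits n x < _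
      rw [Finset.range_add_one, Finset.filter_insert, if_pos rfl,
        Finset.card_insert_of_notMem (by simp)]
      exact Nat.lt_succ_self _
    rw [followEvent_succ]
    by_cases h1 : x (n + 1) = x n + 1
    · rw [h1, followEvent_inter_up]
      exact @MeasurableSet.inter _ (arrowSigma _) _ _ (hS _ ih) (measurableSet_arrow he true)
    by_cases h2 : x (n + 1) = x n - 1
    · rw [h2, followEvent_inter_down]
      exact @MeasurableSet.inter _ (arrowSigma _) _ _ (hS _ ih) (measurableSet_arrow he false)
    · convert @MeasurableSet.empty _ (arrowSigma _)
      refine Set.eq_empty_of_forall_notMem fun ω hω => ?_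
      have a := walk_succ_of_mem hω.1
      have b : walk (n + 1) ω = x (n + 1) := hω.2
      split_ifs at a <;> omega

lemma measurableSet_followEvent' (n : ℕ) (x : ℕ → ℤ) : MeasurableSet (followEvent n x) :=
  arrowSigma_le _ _ (measurableSet_followEvent n x)

lemma arrowLaw_followEvent_inter (s : ℕ → ℝ) (n : ℕ) (x : ℕ → ℤ) (b : Bool) :
    arrowLaw s (followEvent n x ∩ {ω | ω (x n, visits n x) = b})
      = coin (s (visits n x)) {b} * arrowLaw s (followEvent n x) := by
  rw [arrowLaw_inter s _ (measurableSet_followEvent n x)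
    (measurableSet_arrow (Set.mem_singleton (x n, visits n x)) b), arrowLaw_coord, mul_comm]
  rw [Set.disjoint_singleton_right]
  exact lt_irrefl (visits n x)

lemma arrowLaw_up {M : ℕ} {s : ℕ → ℝ} (h : IsEnv M s) (n : ℕ) (x : ℕ → ℤ) :
    arrowLaw s (followEvent n x ∩ {ω | walk (n + 1) ω = x n + 1})
      = ENNReal.ofReal (s (visits n x)) * arrowLaw s (followEvent n x) := by
  rw [followEvent_inter_up, arrowLaw_followEvent_inter, coin_true (h.nonneg _) (h.le_one _)]

lemma arrowLaw_down {M : ℕ} {s : ℕ → ℝ} (h : IsEnv M s) (n : ℕ) (x : ℕ → ℤ) :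
    arrowLaw s (followEvent n x ∩ {ω | walk (n + 1) ω = x n - 1})
      = ENNReal.ofReal (1 - s (visits n x)) * arrowLaw s (followEvent n x) := by
  rw [followEvent_inter_down, arrowLaw_followEvent_inter, coin_false (h.nonneg _) (h.le_one _)]

/-- The trajectory of the walk up to time `n`. -/
def pathOf (n : ℕ) (ω : Arrows) : Fin (n + 1) → ℤ := fun i => walk i ω

/-- The extension of a finite trajectory by zero. -/
def extendPath {n : ℕ} (y : Fin (n + 1) → ℤ) (k : ℕ) : ℤ := if h : k < n + 1 then y ⟨k, h⟩ else 0

lemma pathOf_preimage (n : ℕ) (y : Fin (n + 1) → ℤ) :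
    pathOf n ⁻¹' {y} = followEvent n (extendPath y) := by
  ext ω
  constructor
  · intro h k hk
    have h' : pathOf n ω = y := h
    rw [extendPath, dif_pos (by omega), ← h', pathOf]
  · intro h
    refine funext fun i => ?_
    have := h i (by omega)
    rw [extendPath, dif_pos i.2] at this
    exact this

lemma measurable_pathOf (n : ℕ) : Measurable (pathOf n) :=
  measurable_to_countable' fun y => by
    rw [pathOf_preimage]
    exact measurableSet_followEvent' _ _

lemma measurable_walk (n : ℕ) : Measurable (walk n) :=
  (measurable_pi_apply (Fin.last n)).comp (measurable_pathOf n)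

/-- The environment in which the `i`-th departure from a site uses the `(i + 1)`-st cookie. -/
def cookieEnv (M : ℕ) (p : Fin M → ℝ) (i : ℕ) : ℝ := strength M p (i + 1)

lemma isEnv_cookieEnv {M : ℕ} {p : Fin M → ℝ} (hp : p ∈ OmegaU M) : IsEnv M (cookieEnv M p) where
  half_le i := by
    unfold cookieEnv strength
    split_ifs
    · exact (hp _).1
    · exact le_rfl
  lt_one i := by
    unfold cookieEnv strength
    split_ifs
    · exact (hp _).2
    · norm_num
  eq_half i hi := by
    unfold cookieEnv strength
    rw [dif_neg (by omega)]

lemma continuous_cookieEnv (M i : ℕ) : Continuous fun p : Fin M → ℝ => cookieEnv M p i := by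
  unfold cookieEnv strength
  split_ifs <;> fun_prop

lemma isCookieRW_walk {M : ℕ} {p : Fin M → ℝ} (hp : p ∈ OmegaU M) :
    IsCookieRW M p (arrowLaw (cookieEnv M p)) walk where
  isProb := inferInstance
  meas := measurable_walk
  init := by
    simp [walk_zero]
  nearest := by
    convert measure_univ (μ := arrowLaw (cookieEnv M p))
    refine Set.eq_univ_of_forall fun ω n => ?_
    rcases walk_succ_eq_or ω n with e | e <;> rw [e] <;> simp
  step n x := by
    have e : ((Finset.range (n + 1)).filter fun i => x i = x n).card = visits n x + 1 := by
      rw [Finset.range_add_one, Finset.filter_insert, if_pos rfl,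
        Finset.card_insert_of_notMem (by simp), visits]
    rw [e]
    exact arrowLaw_up (isEnv_cookieEnv hp) n x

/-- The filtration generated by the walk. -/
def walkFiltration : Filtration ℕ (inferInstance : MeasurableSpace Arrows) where
  seq n := MeasurableSpace.comap (pathOf n) inferInstance
  mono' i j hij := by
    have e : pathOf i = (fun (y : Fin (j + 1) → ℤ) (k : Fin (i + 1)) =>
        y ⟨k, k.2.trans_le (Nat.succ_le_succ hij)⟩) ∘ pathOf j := rfl
    dsimp only
    rw [e, ← MeasurableSpace.comap_comp]
    exact MeasurableSpace.comap_mono (Measurable.comap_le (by fun_prop))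
  le' n := (measurable_pathOf n).comap_le

lemma integrable_walk (s : ℕ → ℝ) (n : ℕ) :
    Integrable (fun ω => (walk n ω : ℝ)) (arrowLaw s) := by
  have := measurable_walk n
  refine Integrable.of_bound (C := n) (by fun_prop) (ae_of_all _ fun ω => ?_)
  rw [Real.norm_eq_abs]
  exact_mod_cast walk_le ω n

lemma measurableSet_walk_succ_eq (n : ℕ) (a : ℤ) :
    MeasurableSet {ω | walk (n + 1) ω = walk n ω + a} :=
  measurableSet_eq_fun (measurable_walk _) ((measurable_walk n).add_const a)

lemma measure_preimage_pathOf_inter (P : Measure Arrows) (n : ℕ) (A : Set (Fin (n + 1) → ℤ))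
    (a : ℤ) : P (pathOf n ⁻¹' A ∩ {ω | walk (n + 1) ω = walk n ω + a})
      = ∑' y : A, P (followEvent n (extendPath y.1)
        ∩ {ω | walk (n + 1) ω = extendPath y.1 n + a}) := by
  have e : pathOf n ⁻¹' A ∩ {ω | walk (n + 1) ω = walk n ω + a}
      = ⋃ y ∈ A, (pathOf n ⁻¹' {y} ∩ {ω | walk (n + 1) ω = walk n ω + a}) := by
    ext ω
    simp only [Set.mem_inter_iff, Set.mem_preimage, Set.mem_iUnion, Set.mem_singleton_iff,
      exists_prop]
    exact ⟨fun h => ⟨_, h.1, rfl, h.2⟩, fun ⟨y, h1, h2, h3⟩ => ⟨h2 ▸ h1, h3⟩⟩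
  rw [e, measure_biUnion A.to_countable]
  · refine tsum_congr fun y => ?_
    rw [pathOf_preimage]
    congr 1
    ext ω
    refine and_congr_right fun h => ?_
    have := h n le_rfl
    simp only [Set.mem_ofPred_eq, this]
  · intro y _ z _ hyz
    refine Set.disjoint_left.2 fun ω h1 h2 => hyz ?_
    exact h1.1.symm.trans h2.1
  · intro y _
    exact ((measurable_pathOf n) (measurableSet_singleton y)).inter (measurableSet_walk_succ_eq n a)

lemma IsEnv.submartingale_walk {M : ℕ} {s : ℕ → ℝ} (h : IsEnv M s) :
    Submartingale (fun n ω => (walk n ω : ℝ)) walkFiltration (arrowLaw s) := by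
  refine submartingale_of_setIntegral_le_succ (fun n => ?_) (integrable_walk s) ?_
  · refine Measurable.stronglyMeasurable ?_
    have : Measurable[MeasurableSpace.comap (pathOf n) inferInstance] (pathOf n) :=
      comap_measurable _
    have g : Measurable fun y : Fin (n + 1) → ℤ => ((y (Fin.last n) : ℤ) : ℝ) := by fun_prop
    exact g.comp this
  · rintro n _ ⟨A, hA, rfl⟩
    have hm : MeasurableSet (pathOf n ⁻¹' A) := measurable_pathOf n hA
    have hle : arrowLaw s (pathOf n ⁻¹' A ∩ {ω | walk (n + 1) ω = walk n ω + -1})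
        ≤ arrowLaw s (pathOf n ⁻¹' A ∩ {ω | walk (n + 1) ω = walk n ω + 1}) := by
      rw [measure_preimage_pathOf_inter, measure_preimage_pathOf_inter]
      refine ENNReal.tsum_le_tsum fun y => ?_
      simp only [← sub_eq_add_neg]
      rw [arrowLaw_up h, arrowLaw_down h]
      gcongr
      have := h.half_le (visits n (extendPath y.1))
      linarith
    have hu := measurableSet_walk_succ_eq n 1
    have hd := measurableSet_walk_succ_eq n (-1)
    have e : ∀ ω, (walk (n + 1) ω : ℝ) - walk n ω
        = Set.indicator {ω | walk (n + 1) ω = walk n ω + 1} (fun _ => (1 : ℝ)) ω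
          - Set.indicator {ω | walk (n + 1) ω = walk n ω + -1} (fun _ => (1 : ℝ)) ω := by
      intro ω
      rcases walk_succ_eq_or ω n with h | h <;> simp [Set.indicator, h, sub_eq_add_neg]
    rw [← sub_nonneg, ← integral_sub (integrable_walk s _).integrableOn
      (integrable_walk s _).integrableOn]
    simp only [e]
    rw [integral_sub ((integrable_const _).indicator hu) ((integrable_const _).indicator hd),
      sub_nonneg,
      integral_indicator_const _ hu, integral_indicator_const _ hd]
    simp only [smul_eq_mul, mul_one]
    rw [measureReal_restrict_apply hu, measureReal_restrict_apply hd, Set.inter_comm,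
      Set.inter_comm _ (pathOf n ⁻¹' A)]
    exact ENNReal.toReal_mono (measure_ne_top _ _) hle

lemma IsEnv.ae_exists_le_walk {M : ℕ} {s : ℕ → ℝ} (h : IsEnv M s) :
    ∀ᵐ ω ∂arrowLaw s, ∀ m : ℕ, ∃ n, (m : ℤ) ≤ walk n ω := by
  have hstep : ∀ ω n, |(walk (n + 1) ω : ℝ) - walk n ω| = 1 := by
    intro ω n
    rcases walk_succ_eq_or ω n with h | h <;> rw [h] <;> simp
  filter_upwards [h.submartingale_walk.bddAbove_iff_exists_tendsto (R := 1)
    (ae_of_all _ fun ω n => by rw [hstep]; simp)] with ω hω m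
  by_contra! hc
  obtain ⟨c, hc⟩ := hω.1 ⟨m, by rintro _ ⟨n, rfl⟩; dsimp only; exact_mod_cast (hc n).le⟩
  have h0 := ((hc.comp (tendsto_add_atTop_nat 1)).sub hc).abs
  simp only [Function.comp_def, hstep, sub_self, abs_zero] at h0
  exact one_ne_zero (tendsto_nhds_unique tendsto_const_nhds h0)

namespace IsEnv

variable {M : ℕ} {s : ℕ → ℝ} {v : ℝ}

lemma speed_nonneg (h : IsEnv M s)
    (hv : ∀ᵐ ω ∂arrowLaw s, Tendsto (fun n => (walk n ω : ℝ) / n) atTop (𝓝 v)) : 0 ≤ v := by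
  obtain ⟨ω, hω, hω'⟩ := (hv.and h.ae_exists_le_walk).exists
  by_contra! hlt
  obtain ⟨N, hN⟩ := eventually_atTop.1 (hω.eventually_lt_const hlt)
  obtain ⟨n, hn⟩ := hω' (N + 1)
  rcases lt_or_ge n N with hc | hc
  · have := (abs_le.1 (walk_le ω n)).2
    omega
  · have h1 : (0 : ℝ) ≤ walk n ω := by exact_mod_cast (by omega : 0 ≤ walk n ω)
    exact (hN n hc).not_ge (by positivity)

end IsEnv

lemma tendsto_div_hit {ω : Arrows} {v : ℝ}
    (hv : Tendsto (fun n => (walk n ω : ℝ) / n) atTop (𝓝 v)) {τ : ℕ → ℕ}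
    (hτ : ∀ m, IsHit ω m (τ m)) : Tendsto (fun m : ℕ => (m : ℝ) / τ m) atTop (𝓝 v) := by
  have := hv.comp (tendsto_atTop_mono (fun m => (hτ m).le) tendsto_id)
  refine this.congr fun m => ?_
  simp only [Function.comp_def, (hτ m).1, Int.cast_natCast]

/-- The mean over `{0, …, m - 1}` of the numbers of left departures, truncated at `K`, before `m`
is hit. -/
def meanDown (K m : ℕ) (ω : Arrows) : ℝ :=
  (∑ y ∈ Finset.range m, ((min (downcross ω y (m - y)) K : ℕ) : ℝ)) / m

lemma meanDown_nonneg (K m : ℕ) (ω : Arrows) : 0 ≤ meanDown K m ω := by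
  unfold meanDown; positivity

lemma meanDown_le (K m : ℕ) (ω : Arrows) : meanDown K m ω ≤ K := by
  refine div_le_of_le_mul₀ (by positivity) (by positivity) ?_
  calc _ ≤ ∑ y ∈ Finset.range m, (K : ℝ) :=
        Finset.sum_le_sum fun y _ => by exact_mod_cast min_le_right _ _
    _ = K * m := by simp [mul_comm]

lemma meanDown_le_totalDown (K m : ℕ) (ω : Arrows) : meanDown K m ω ≤ totalDown ω m / m := by
  unfold meanDown totalDown
  push_cast
  gcongr
  exact min_le_left _ _

lemma measurable_meanDown (K m : ℕ) : Measurable (meanDown K m) := by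
  unfold meanDown
  refine (Finset.measurable_sum _ fun y _ => ?_).div_const _
  exact (measurable_of_countable fun j : ℕ => ((min j K : ℕ) : ℝ)).comp (measurable_downcross _ _)

namespace IsEnv

variable {M : ℕ} {s : ℕ → ℝ} {v : ℝ}

lemma integral_natMin_downcross (h : IsEnv M s) (K : ℕ) (x : ℤ) (r : ℕ) :
    ∫ ω, ((min (downcross ω x r) K : ℕ) : ℝ) ∂arrowLaw s
      = chain s r fun j => ((min j K : ℕ) : ℝ) := by
  have hm : Measurable fun ω => ((min (downcross ω x r) K : ℕ) : ℝ) :=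
    (measurable_of_countable fun j : ℕ => ((min j K : ℕ) : ℝ)).comp (measurable_downcross x r)
  rw [integral_eq_lintegral_of_nonneg_ae (ae_of_all _ fun ω => by
      simp only [Pi.zero_apply]; positivity)
    hm.aestronglyMeasurable,
    h.lintegral_downcross (φ := fun j => ((min j K : ℕ) : ℝ)) (quadBdd_natMin K)
      (fun j => by positivity) x r, ENNReal.toReal_ofReal]
  have := h.chain_mono (QuadBdd.const 0) (quadBdd_natMin K) (fun j => by positivity) r
  rwa [h.chain_const] at this

lemma integrable_meanDown (s : ℕ → ℝ) (K m : ℕ) : Integrable (meanDown K m) (arrowLaw s) :=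
  Integrable.of_bound (measurable_meanDown K m).aestronglyMeasurable K (ae_of_all _ fun ω => by
    rw [Real.norm_of_nonneg (meanDown_nonneg K m ω)]
    exact meanDown_le K m ω)

lemma le_integral_meanDown (h : IsEnv M s) (K : ℕ) {n m : ℕ} (hnm : n ≤ m) :
    (1 - n / m) * chain s n (fun j => ((min j K : ℕ) : ℝ)) ≤ ∫ ω, meanDown K m ω ∂arrowLaw s := by
  set c := fun n => chain s n (fun j => ((min j K : ℕ) : ℝ)) with hc
  have hmono : Monotone c := h.monotone_chain (quadBdd_natMin K) fun a b hab => by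
    exact_mod_cast min_le_min_right K hab
  have hc0 : ∀ r, 0 ≤ c r := fun r => by
    have := h.chain_mono (QuadBdd.const 0) (quadBdd_natMin K) (fun j => by positivity) r
    rwa [h.chain_const] at this
  rcases Nat.eq_zero_or_pos m with rfl | hm
  · obtain rfl : n = 0 := by omega
    simp [meanDown, chain_zero]
  have e : ∫ ω, meanDown K m ω ∂arrowLaw s = (∑ y ∈ Finset.range m, c (m - y)) / m := by
    unfold meanDown
    rw [integral_div, integral_finsetSum]
    · simp only [h.integral_natMin_downcross, hc]
    · intro y _
      refine Integrable.of_bound ((measurable_of_countable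
        fun j : ℕ => ((min j K : ℕ) : ℝ)).comp (measurable_downcross _ _)).aestronglyMeasurable K
        (ae_of_all _ fun ω => ?_)
      rw [Real.norm_of_nonneg (by positivity)]
      exact_mod_cast min_le_right _ _
  have hm' : (0 : ℝ) < m := by exact_mod_cast hm
  rw [e, le_div_iff₀ hm']
  calc (1 - (n : ℝ) / m) * c n * m = ∑ y ∈ Finset.range (m - n), c n := by
        rw [Finset.sum_const, Finset.card_range, nsmul_eq_mul, Nat.cast_sub hnm]
        field_simp
    _ ≤ ∑ y ∈ Finset.range (m - n), c (m - y) := Finset.sum_le_sum fun y hy =>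
        hmono (by have := Finset.mem_range.1 hy; omega)
    _ ≤ ∑ y ∈ Finset.range m, c (m - y) :=
        Finset.sum_le_sum_of_subset_of_nonneg (Finset.range_subset_range.2 (Nat.sub_le m n))
          fun y _ _ => hc0 _

/-- A walk with positive speed makes few left departures per site. -/
theorem chain_le_of_speed_pos (h : IsEnv M s)
    (hv : ∀ᵐ ω ∂arrowLaw s, Tendsto (fun n => (walk n ω : ℝ) / n) atTop (𝓝 v)) (hpos : 0 < v)
    (n : ℕ) : chain s n (fun j => (j : ℝ)) ≤ (1 / v - 1) / 2 := by
  set c := (1 / v - 1) / 2 with hc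
  have key : ∀ K : ℕ, chain s n (fun j => ((min j K : ℕ) : ℝ)) ≤ c := by
    intro K
    have hlim : ∀ᵐ ω ∂arrowLaw s,
        Tendsto (fun m => max (meanDown K m ω - c) 0) atTop (𝓝 0) := by
      filter_upwards [hv, h.ae_exists_le_walk] with ω h1 h2
      choose τ hτ using exists_isHit h2
      have h3 : Tendsto (fun m : ℕ => (((m : ℝ) / τ m)⁻¹ - 1) / 2 - c) atTop (𝓝 0) := by
        have := (((tendsto_div_hit h1 hτ).inv₀ hpos.ne').sub_const 1).div_const 2 |>.sub_const c
        rwa [← one_div, ← hc, sub_self] at this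
      have h4 := h3.max (tendsto_const_nhds (x := (0 : ℝ)))
      rw [max_self] at h4
      refine squeeze_zero' (Eventually.of_forall fun m => le_max_right _ _) ?_ h4
      filter_upwards [eventually_gt_atTop 0] with m hm
      refine max_le_max_right 0 (sub_le_sub_right ((meanDown_le_totalDown K m ω).trans ?_) c)
      have hm' : (0 : ℝ) < m := by exact_mod_cast hm
      have h5 : (m : ℝ) + 2 * totalDown ω m ≤ τ m := by exact_mod_cast (hτ m).add_two_mul_le
      rw [inv_div, div_le_div_iff₀ hm' two_pos, sub_mul, div_mul_cancel₀ _ hm'.ne']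
      linarith
    have hint : Tendsto (fun m => ∫ ω, max (meanDown K m ω - c) 0 ∂arrowLaw s) atTop (𝓝 0) := by
      have := tendsto_integral_of_dominated_convergence (μ := arrowLaw s)
        (F := fun m ω => max (meanDown K m ω - c) 0) (f := fun _ => 0) (fun _ => (K : ℝ) + |c|)
        (fun m => (((measurable_meanDown K m).sub_const c).max
          measurable_const).aestronglyMeasurable) (integrable_const _)
        (fun m => ae_of_all _ fun ω => ?_) hlim
      · simpa using this
      · rw [Real.norm_of_nonneg (le_max_right _ _)]
        refine max_le ?_ (by positivity)
        have := meanDown_le K m ω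
        have := neg_abs_le c
        linarith
    have hle : ∀ᶠ m : ℕ in atTop, (1 - (n : ℝ) / m) * chain s n (fun j => ((min j K : ℕ) : ℝ))
        ≤ c + ∫ ω, max (meanDown K m ω - c) 0 ∂arrowLaw s := by
      filter_upwards [eventually_ge_atTop n] with m hm
      refine (h.le_integral_meanDown K hm).trans ?_
      have i1 := integrable_meanDown s K m
      have i2 : Integrable (fun ω => max (meanDown K m ω - c) 0) (arrowLaw s) :=
        (i1.sub (integrable_const c)).pos_part
      have := integral_mono i1 ((integrable_const c).add i2) (fun ω => by
        have := le_max_left (meanDown K m ω - c) 0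
        show meanDown K m ω ≤ c + max (meanDown K m ω - c) 0
        linarith)
      rw [integral_add' (integrable_const c) i2] at this
      simpa using this
    have l1 : Tendsto (fun m : ℕ => (1 - (n : ℝ) / m)
        * chain s n (fun j => ((min j K : ℕ) : ℝ))) atTop
        (𝓝 ((1 - 0) * chain s n (fun j => ((min j K : ℕ) : ℝ)))) :=
      ((tendsto_const_div_atTop_nhds_zero_nat (n : ℝ)).const_sub 1).mul_const _
    have l2 := hint.const_add c
    have := le_of_tendsto_of_tendsto l1 l2 hle
    simpa using this
  obtain ⟨C, hC⟩ := QuadBdd.natCast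
  refine le_of_tendsto' (tendsto_chain (l := atTop) (s := fun _ : ℕ => s) (C := C)
    (φ := fun K j => ((min j K : ℕ) : ℝ)) (Eventually.of_forall fun _ => h)
    (fun i => tendsto_const_nhds) (Eventually.of_forall fun K j => ?_) (fun j => ?_) n) key
  · refine le_trans ?_ (hC j)
    rw [abs_of_nonneg (by positivity), abs_of_nonneg (by positivity)]
    dsimp only
    exact_mod_cast min_le_left _ _
  · refine tendsto_const_nhds.congr' ?_
    filter_upwards [eventually_ge_atTop j] with K hK
    rw [min_eq_left hK]

lemma ae_bddAbove_downcross (h : IsEnv M s) {B : ℝ} (hB : ∀ n, chain s n (fun j => (j : ℝ)) ≤ B) :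
    ∀ᵐ ω ∂arrowLaw s, ∃ N : ℕ, ∀ m, downcross ω 0 m ≤ N := by
  have hmono : ∀ᵐ ω ∂arrowLaw s, Monotone fun m => (downcross ω 0 m : ℝ≥0∞) := by
    filter_upwards [h.ae_exists_le_walk] with ω h2
    choose τ hτ using exists_isHit h2
    intro m m' hm
    have a := (hτ m).downs_eq (Nat.zero_le m)
    have b := (hτ m').downs_eq (Nat.zero_le m')
    simp only [Nat.cast_zero, Nat.sub_zero] at a b
    dsimp only
    rw [← a, ← b]
    exact_mod_cast monotone_downs ω 0 ((hτ m).mono (hτ m') hm)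
  have hmeas : ∀ m, AEMeasurable (fun ω => (downcross ω 0 m : ℝ≥0∞)) (arrowLaw s) := fun m =>
    ((measurable_of_countable fun j : ℕ => (j : ℝ≥0∞)).comp (measurable_downcross 0 m)).aemeasurable
  have hsup : ∫⁻ ω, ⨆ m, (downcross ω 0 m : ℝ≥0∞) ∂arrowLaw s ≤ ENNReal.ofReal B := by
    rw [lintegral_iSup' hmeas hmono]
    refine iSup_le fun m => ?_
    have := h.lintegral_downcross QuadBdd.natCast (fun j => by positivity) 0 m
    simp only [ENNReal.ofReal_natCast] at this
    rw [this]
    exact ENNReal.ofReal_le_ofReal (hB m)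
  filter_upwards [ae_lt_top' (AEMeasurable.iSup hmeas)
    (hsup.trans_lt ENNReal.ofReal_lt_top).ne] with ω hω
  obtain ⟨N, hN⟩ := ENNReal.exists_nat_gt hω.ne
  exact ⟨N, fun m => by exact_mod_cast (le_iSup (fun m => (downcross ω 0 m : ℝ≥0∞)) m).trans hN.le⟩

lemma lintegral_totalDown_le (h : IsEnv M s) {B : ℝ}
    (hB : ∀ n, chain s n (fun j => (j : ℝ)) ≤ B) (m : ℕ) :
    ∫⁻ ω, ENNReal.ofReal (totalDown ω m / m) ∂arrowLaw s ≤ ENNReal.ofReal B := by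
  have hB0 : 0 ≤ B := by simpa [chain_zero] using hB 0
  rcases Nat.eq_zero_or_pos m with rfl | hm
  · simp
  have hm' : (0 : ℝ) < m := by exact_mod_cast hm
  have e : ∀ ω, ENNReal.ofReal (totalDown ω m / m)
      = (∑ y ∈ Finset.range m, ENNReal.ofReal (downcross ω y (m - y))) / ENNReal.ofReal m := by
    intro ω
    rw [ENNReal.ofReal_div_of_pos hm', totalDown]
    push_cast
    rw [ENNReal.ofReal_sum_of_nonneg fun y _ => by positivity]
  simp only [e]
  simp only [div_eq_mul_inv]
  have hmeas : ∀ y ∈ Finset.range m,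
      Measurable fun ω : Arrows => ENNReal.ofReal (downcross ω y (m - y)) := fun y _ =>
    (measurable_of_countable fun j : ℕ => ENNReal.ofReal (j : ℝ)).comp (measurable_downcross _ _)
  rw [lintegral_mul_const _ (Finset.measurable_sum _ hmeas), lintegral_finsetSum _ hmeas]
  rw [← div_eq_mul_inv]
  refine ENNReal.div_le_of_le_mul ?_
  calc _ ≤ ∑ y ∈ Finset.range m, ENNReal.ofReal B := Finset.sum_le_sum fun y _ => by
        rw [h.lintegral_downcross QuadBdd.natCast (fun j => by positivity)]
        exact ENNReal.ofReal_le_ofReal (hB _)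
    _ = _ := by
        rw [Finset.sum_const, Finset.card_range, nsmul_eq_mul, ENNReal.ofReal_natCast, mul_comm]

/-- A walk making few left departures per site has a positive speed. -/
theorem one_div_le_speed (h : IsEnv M s)
    (hv : ∀ᵐ ω ∂arrowLaw s, Tendsto (fun n => (walk n ω : ℝ) / n) atTop (𝓝 v))
    {B : ℝ} (hB : ∀ n, chain s n (fun j => (j : ℝ)) ≤ B) : 1 / (1 + 2 * B) ≤ v := by
  have hB0 : 0 ≤ B := by simpa [chain_zero] using hB 0
  by_contra! hlt
  obtain ⟨q, hvq, hq⟩ := exists_between hlt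
  have hq0 : 0 < q := (h.speed_nonneg hv).trans_lt hvq
  have hd : B < (1 / q - 1) / 2 := by
    rw [lt_one_div hq0 (by positivity)] at hq
    linarith
  obtain ⟨e, hBe, hed⟩ := exists_between hd
  have hlow : ∀ᵐ ω ∂arrowLaw s, ENNReal.ofReal e
      ≤ liminf (fun m : ℕ => ENNReal.ofReal (totalDown ω m / m)) atTop := by
    filter_upwards [hv, h.ae_exists_le_walk, h.ae_bddAbove_downcross hB] with ω h1 h2 ⟨b, hb⟩
    choose τ hτ using exists_isHit h2
    obtain ⟨N, hN⟩ := exists_negTime_le hτ hb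
    refine le_liminf_of_le (by isBoundedDefault) ?_
    have hsmall : ∀ᶠ m : ℕ in atTop, (N : ℝ) / m / 2 < (1 / q - 1) / 2 - e := by
      have := ((tendsto_const_div_atTop_nhds_zero_nat (N : ℝ)).div_const 2)
      rw [zero_div] at this
      exact this.eventually_lt_const (by linarith)
    filter_upwards [(tendsto_div_hit h1 hτ).eventually_lt_const hvq, hsmall,
      eventually_gt_atTop 0] with m a b hm
    refine ENNReal.ofReal_le_ofReal ?_
    have hm' : (0 : ℝ) < m := by exact_mod_cast hm
    have hτ0 : (0 : ℝ) < τ m := hm'.trans_le (by exact_mod_cast (hτ m).le)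
    have c : (τ m : ℝ) ≤ N + m + 2 * totalDown ω m := by
      exact_mod_cast (hτ m).le_add.trans (by have := hN (τ m); omega)
    rw [div_lt_iff₀ hτ0] at a
    have d : (1 / q) * m < τ m := by
      rw [div_mul_eq_mul_div, one_mul, div_lt_iff₀ hq0]; linarith
    rw [le_div_iff₀ hm']
    have f := mul_lt_mul_of_pos_right b hm'
    have g : (N : ℝ) / m / 2 * m = N / 2 := by field_simp
    rw [g] at f
    linarith
  have hfin : ∫⁻ _, ENNReal.ofReal e ∂arrowLaw s ≤ ENNReal.ofReal B := by
    refine (lintegral_mono_ae hlow).trans ((lintegral_liminf_le' fun m => ?_).trans ?_)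
    · refine Measurable.aemeasurable (Measurable.ennreal_ofReal (Measurable.div_const ?_ _))
      unfold totalDown
      push_cast
      exact Finset.measurable_sum _ fun y _ =>
        (measurable_of_countable fun j : ℕ => (j : ℝ)).comp (measurable_downcross _ _)
    · exact liminf_le_of_frequently_le'
        (Frequently.of_forall fun m => h.lintegral_totalDown_le hB m)
  rw [lintegral_const, measure_univ, mul_one, ENNReal.ofReal_le_ofReal_iff hB0] at hfin
  linarith

end IsEnv

/-- **Theorem 1.2 (first part).** The speed `p̄ ↦ v(M,p̄)` is a continuous function
of `p̄` on `Ω^u_M`. -/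
theorem speed_continuousOn
    (M : ℕ) (hM : 1 ≤ M) (V : (Fin M → ℝ) → ℝ)
    (hV : ∀ p ∈ OmegaU M, ∀ (Ω : Type) [MeasurableSpace Ω] (P : Measure Ω)
      (X : ℕ → Ω → ℤ), IsCookieRW M p P X →
      ∀ᵐ ω ∂P, Tendsto (fun n => (X n ω : ℝ) / n) atTop (𝓝 (V p))) :
    ContinuousOn V (OmegaU M) := by
  have hv : ∀ p ∈ OmegaU M, ∀ᵐ ω ∂arrowLaw (cookieEnv M p),
      Tendsto (fun n => (walk n ω : ℝ) / n) atTop (𝓝 (V p)) := fun p hp =>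
    hV p hp Arrows (arrowLaw (cookieEnv M p)) walk (isCookieRW_walk hp)
  intro p hp
  have hs : ∀ᶠ q in 𝓝[OmegaU M] p, IsEnv M (cookieEnv M q) := by
    filter_upwards [self_mem_nhdsWithin] with q hq using isEnv_cookieEnv hq
  have hst : ∀ i, Tendsto (fun q => cookieEnv M q i) (𝓝[OmegaU M] p) (𝓝 (cookieEnv M p i)) :=
    fun i => (continuous_cookieEnv M i).continuousWithinAt
  have ht := isEnv_cookieEnv hp
  have hnn : ∀ q ∈ OmegaU M, ∀ n, 0 ≤ chain (cookieEnv M q) n (fun j => (j : ℝ)) := by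
    intro q hq n
    have := (isEnv_cookieEnv hq).chain_mono (QuadBdd.const 0) QuadBdd.natCast
      (fun j => by positivity) n
    rwa [(isEnv_cookieEnv hq).chain_const] at this
  have hup : ∀ q ∈ OmegaU M, ∀ n,
      V q ≤ 1 / (1 + 2 * chain (cookieEnv M q) n (fun j => (j : ℝ))) := by
    intro q hq n
    have h0 := hnn q hq n
    rcases le_or_gt (V q) 0 with h | h
    · exact h.trans (by positivity)
    · have := (isEnv_cookieEnv hq).chain_le_of_speed_pos (hv q hq) h n
      rw [le_one_div h (by positivity)]
      linarith
  have hlow : ∀ q ∈ OmegaU M, ∀ B, (∀ n, chain (cookieEnv M q) n (fun j => (j : ℝ)) ≤ B) →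
      1 / (1 + 2 * B) ≤ V q := fun q hq B hB =>
    (isEnv_cookieEnv hq).one_div_le_speed (hv q hq) hB
  have hchain : ∀ n, Tendsto (fun q => chain (cookieEnv M q) n (fun j => (j : ℝ)))
      (𝓝[OmegaU M] p) (𝓝 (chain (cookieEnv M p) n (fun j => (j : ℝ)))) := fun n => by
    obtain ⟨C, hC⟩ := QuadBdd.natCast
    exact tendsto_chain hs hst (Eventually.of_forall fun _ => hC) (fun _ => tendsto_const_nhds) n
  refine tendsto_order.2 ⟨fun a ha => ?_, fun a ha => ?_⟩
  · rcases lt_or_ge a 0 with h0 | h0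
    · filter_upwards [self_mem_nhdsWithin] with q hq
      exact h0.trans_le ((isEnv_cookieEnv hq).speed_nonneg (hv q hq))
    have hpos : 0 < V p := h0.trans_lt ha
    have hB := ht.chain_le_of_speed_pos (hv p hp) hpos
    set B := (1 / V p - 1) / 2 with hBdef
    have hB0 : 0 ≤ B := (hnn p hp 0).trans (hB 0)
    have hc : Tendsto (fun ε : ℝ => 1 / (1 + 2 * (B + ε))) (𝓝[>] 0) (𝓝 (V p)) := by
      have : ContinuousAt (fun ε : ℝ => 1 / (1 + 2 * (B + ε))) 0 :=
        ContinuousAt.div (by fun_prop) (by fun_prop) (by positivity)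
      have h1 := this.tendsto.mono_left (nhdsWithin_le_nhds (s := Set.Ioi 0))
      convert h1 using 2
      rw [hBdef]
      field_simp
      ring
    obtain ⟨ε, hε, hε0⟩ := ((hc.eventually_const_lt ha).and self_mem_nhdsWithin).exists
    filter_upwards [IsEnv.eventually_chain_le hs ht hst hB hε0, self_mem_nhdsWithin] with q hq hqΩ
    exact hε.trans_le (hlow q hqΩ _ hq)
  · obtain ⟨n, hn⟩ : ∃ n, 1 / (1 + 2 * chain (cookieEnv M p) n (fun j => (j : ℝ))) < a := by
      by_contra! hc
      have ha0 : 0 < a := (ht.speed_nonneg (hv p hp)).trans_lt ha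
      refine ha.not_ge ?_
      have hB : ∀ n, chain (cookieEnv M p) n (fun j => (j : ℝ)) ≤ (1 / a - 1) / 2 := fun n => by
        have h0 := hnn p hp n
        have := hc n
        rw [le_one_div ha0 (by positivity)] at this
        linarith
      have := hlow p hp _ hB
      rwa [show 1 + 2 * ((1 / a - 1) / 2) = 1 / a by ring, one_div_one_div] at this
    have h0 := hnn p hp n
    have hlim : Tendsto (fun q => 1 / (1 + 2 * chain (cookieEnv M q) n (fun j => (j : ℝ))))
        (𝓝[OmegaU M] p) (𝓝 (1 / (1 + 2 * chain (cookieEnv M p) n (fun j => (j : ℝ))))) :=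
      tendsto_const_nhds.div (((hchain n).const_mul 2).const_add 1) (by positivity)
    filter_upwards [hlim.eventually_lt_const hn, self_mem_nhdsWithin] with q hq hqΩ
    exact (hup q hqΩ n).trans_lt hq

end
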